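/- Let 1 < s < r be integers with r ≢ 2 (mod 4), both r and s odd, and r ≥ 2^t for a positive integer t, and let n ≥ 2 be an integer. Then, for the free ℤ/2-action on ℝH_{r,s}, n(2^t + s − 1) − s + 2 ≤ TC_{ℤ/2,n}(ℝH_{r,s}) ≤ n(s+r−1) + 1. In particular, if s = 3 and r = 2^t + 1, then n(2^t + 2) − 1 ≤ TC_{ℤ/2,n}(ℝH_{r,3}) ≤ n(2^t + 3) + 1. -/

import Mathlib

open scoped unitInterval

noncomputable section

/-- Topology on the projectivization, as a quotient of the nonzero vectors. -/
instance projTop (K V : Type*) [DivisionRing K] [AddCommGroup V] [Module K V]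
    [TopologicalSpace V] : TopologicalSpace (Projectivization K V) :=
  inferInstanceAs (TopologicalSpace (Quotient (projectivizationSetoid K V)))

/-- The real Milnor manifold `ℝH_{r,s}`, as the subspace of `ℝPʳ × ℝPˢ` of pairs
`([x], [y])` with `x₀y₀ + ⋯ + x_sy_s = 0` (for `s ≤ r`). -/
def RealMilnor (r s : ℕ) :
    Set (Projectivization ℝ (Fin (r + 1) → ℝ) × Projectivization ℝ (Fin (s + 1) → ℝ)) :=
  {p | ∑ i : Fin (min (s + 1) (r + 1)),
      p.1.rep (Fin.castLE (min_le_right _ _) i) * p.2.rep (Fin.castLE (min_le_left _ _) i) = 0}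

/-- The complex Milnor manifold `ℂH_{r,s}`, as the subspace of `ℂPʳ × ℂPˢ` of pairs
`([z], [w])` with `z₀w̄₀ + ⋯ + z_sw̄_s = 0` (for `s ≤ r`). -/
def ComplexMilnor (r s : ℕ) :
    Set (Projectivization ℂ (Fin (r + 1) → ℂ) × Projectivization ℂ (Fin (s + 1) → ℂ)) :=
  {p | ∑ i : Fin (min (s + 1) (r + 1)),
      p.1.rep (Fin.castLE (min_le_right _ _) i) *
        (starRingEnd ℂ) (p.2.rep (Fin.castLE (min_le_left _ _) i)) = 0}

/-- The Lusternik–Schnirelmann category of `X`: the least number of open sets covering `X`,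
each of whose inclusion into `X` is null-homotopic. -/
def lsCat (X : Type*) [TopologicalSpace X] : ℕ :=
  sInf {k | 0 < k ∧ ∃ U : Fin k → Set X,
    (∀ i, IsOpen (U i)) ∧ (⋃ i, U i) = Set.univ ∧
    ∀ i, ∃ x₀ : X, ∃ H : C(U i × I, X),
      (∀ u : U i, H (u, 0) = (u : X)) ∧ (∀ u : U i, H (u, 1) = x₀)}

/-- The fibration `π_n : X^I → X^n`, evaluating a path at the times `i/(n-1)`,
`i = 0, …, n-1`. -/
def tcPi (X : Type*) [TopologicalSpace X] (n : ℕ) (γ : C(I, X)) : Fin n → X :=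
  fun i => γ (Set.projIcc (0 : ℝ) 1 zero_le_one ((i : ℝ) / ((n : ℝ) - 1)))

/-- The `n`-th higher (sequential) topological complexity of `X`: the least number of open
sets covering `X^n`, each admitting a continuous local section of `π_n : X^I → X^n`. -/
def higherTC (X : Type*) [TopologicalSpace X] (n : ℕ) : ℕ :=
  sInf {k | 0 < k ∧ ∃ U : Fin k → Set (Fin n → X),
    (∀ i, IsOpen (U i)) ∧ (⋃ i, U i) = Set.univ ∧
    ∀ i, ∃ sec : C(U i, C(I, X)), ∀ u : U i, tcPi X n (sec u) = (u : Fin n → X)}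

/-- The `n`-th higher equivariant topological complexity of a `G`-space `X`:
the least number of `G`-invariant open sets covering `X^n` (with the diagonal action),
each admitting a `G`-equivariant map to `X^I` whose composite with `π_n` is
`G`-homotopic to the inclusion. -/
def eqHigherTC (G : Type*) [Group G] (X : Type*) [TopologicalSpace X] [MulAction G X]
    (n : ℕ) : ℕ :=
  sInf {k | 0 < k ∧ ∃ U : Fin k → Set (Fin n → X),
    (∀ i, IsOpen (U i)) ∧ (⋃ i, U i) = Set.univ ∧
    (∀ i (g : G), ∀ v ∈ U i, g • v ∈ U i) ∧
    ∀ i, ∃ sec : C(U i, C(I, X)),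
      (∀ (g : G) (v : U i) (hgv : g • (v : Fin n → X) ∈ U i) (t : I),
        (sec ⟨g • (v : Fin n → X), hgv⟩) t = g • (sec v) t) ∧
      ∃ H : C(U i × I, Fin n → X),
        (∀ v : U i, H (v, 0) = tcPi X n (sec v)) ∧
        (∀ v : U i, H (v, 1) = (v : Fin n → X)) ∧
        (∀ (g : G) (v : U i) (hgv : g • (v : Fin n → X) ∈ U i) (t : I),
          H (⟨g • (v : Fin n → X), hgv⟩, t) = g • H (v, t))}

/-- `X` has covering dimension at most `m`: every finite open cover admits an open
refinement which still covers `X` and in which every point lies in at most `m + 1` sets. -/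
def HasCovDimLE (X : Type*) [TopologicalSpace X] (m : ℕ) : Prop :=
  ∀ 𝒰 : Set (Set X), 𝒰.Finite → (∀ U ∈ 𝒰, IsOpen U) → ⋃₀ 𝒰 = Set.univ →
    ∃ 𝒱 : Set (Set X), (∀ V ∈ 𝒱, IsOpen V) ∧ ⋃₀ 𝒱 = Set.univ ∧
      (∀ V ∈ 𝒱, ∃ U ∈ 𝒰, V ⊆ U) ∧
      ∀ x : X, {V ∈ 𝒱 | x ∈ V}.encard ≤ (m + 1 : ℕ)

/-- The covering dimension of `X`. -/
def covDim (X : Type*) [TopologicalSpace X] : ℕ :=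
  sInf {m | HasCovDimLE X m}

end

open Function

/-- Cellular coboundary on the cubical lattice (odd coordinates are the interval directions). -/
def cubD {A : Type*} [Fintype A] [DecidableEq A] (φ : (A → ℤ) → ZMod 2) (c : A → ℤ) : ZMod 2 :=
  ∑ a, if Odd (c a) then φ (update c a (c a + 1)) + φ (update c a (c a - 1)) else 0

/-- Cellular representative of a product of one-dimensional classes. -/
def cubT {A : Type*} [Fintype A] [DecidableEq A] :
    List ((A → ℤ) → ZMod 2) → (A → ℤ) → ZMod 2
  | [] => fun _ => 1
  | sgw :: L => cubD (fun c => cubT L c * sgw c)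

theorem sum_symm_zmod2 {A : Type*} [Fintype A] [DecidableEq A] (g : A → A → ZMod 2)
    (hs : ∀ a b, g a b = g b a) (h0 : ∀ a, g a a = 0) : ∑ a, ∑ b, g a b = 0 := by
  rw [← Finset.sum_product']
  refine Finset.sum_involution (fun p _ => p.swap) ?_ ?_ ?_ ?_
  · rintro ⟨a, b⟩ _
    simp only [Prod.swap]
    rw [hs b a]; exact CharTwo.add_self_eq_zero _
  · rintro ⟨a, b⟩ _ h e
    simp only [Prod.swap, Prod.mk.injEq] at e
    obtain ⟨rfl, _⟩ := e
    exact h (h0 _)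
  · simp
  · simp

section
variable {A : Type*} [Fintype A] [DecidableEq A]

theorem cubD_add (φ ψ : (A → ℤ) → ZMod 2) (c : A → ℤ) :
    cubD (fun c => φ c + ψ c) c = cubD φ c + cubD ψ c := by
  unfold cubD
  rw [← Finset.sum_add_distrib]
  refine Finset.sum_congr rfl fun a _ => ?_
  split_ifs <;> ring

theorem cubD_mul_const (φ : (A → ℤ) → ZMod 2) (k : ZMod 2) (c : A → ℤ) :
    cubD (fun c => φ c * k) c = cubD φ c * k := by
  unfold cubD
  rw [Finset.sum_mul]
  refine Finset.sum_congr rfl fun a _ => ?_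
  split_ifs <;> ring

theorem cubD_const (k : ZMod 2) (c : A → ℤ) : cubD (fun _ => k) c = 0 := by
  unfold cubD
  refine Finset.sum_eq_zero fun a _ => ?_
  split_ifs
  · exact CharTwo.add_self_eq_zero _
  · rfl

theorem cubD_cubD (φ : (A → ℤ) → ZMod 2) (c : A → ℤ) : cubD (cubD φ) c = 0 := by
  have key : cubD (cubD φ) c = ∑ a, ∑ b, (if Odd (c a) ∧ Odd (c b) ∧ a ≠ b then
      (φ (update (update c a (c a + 1)) b (c b + 1)) +
       φ (update (update c a (c a + 1)) b (c b - 1)) +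
       φ (update (update c a (c a - 1)) b (c b + 1)) +
       φ (update (update c a (c a - 1)) b (c b - 1))) else 0) := by
    unfold cubD
    refine Finset.sum_congr rfl fun a _ => ?_
    split_ifs with ha
    · rw [← Finset.sum_add_distrib]
      refine Finset.sum_congr rfl fun b _ => ?_
      by_cases hab : b = a
      · subst hab
        have h1 : ¬ Odd (c b + 1) := by rw [Int.not_odd_iff_even]; exact ha.add_odd odd_one
        have h2 : ¬ Odd (c b - 1) := by rw [Int.not_odd_iff_even]; exact ha.sub_odd odd_one
        simp [h1, h2]
      · simp only [update_of_ne hab]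
        by_cases hb : Odd (c b)
        · simp [ha, hb, Ne.symm hab]; ring
        · simp [hb]
    · simp [ha]
  rw [key]
  refine sum_symm_zmod2 _ ?_ (by simp)
  intro a b
  by_cases h : Odd (c a) ∧ Odd (c b) ∧ a ≠ b
  · rw [if_pos h, if_pos ⟨h.2.1, h.1, h.2.2.symm⟩]
    rw [update_comm h.2.2, update_comm h.2.2, update_comm h.2.2, update_comm h.2.2]; ring
  · rw [if_neg h, if_neg (fun h' => h ⟨h'.2.1, h'.1, h'.2.2.symm⟩)]

theorem cubD_cubT (L : List ((A → ℤ) → ZMod 2)) (c : A → ℤ) : cubD (cubT L) c = 0 := by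
  cases L with
  | nil => exact cubD_const _ _
  | cons sgw L => exact cubD_cubD _ _

/-- A set of lattice points closed under passing to facets. -/
def FacetClosed (Q : Set (A → ℤ)) : Prop :=
  ∀ c ∈ Q, ∀ a, Odd (c a) → update c a (c a + 1) ∈ Q ∧ update c a (c a - 1) ∈ Q

theorem cubD_congr {Q : Set (A → ℤ)} (hQ : FacetClosed Q) {φ ψ : (A → ℤ) → ZMod 2}
    (h : ∀ c ∈ Q, φ c = ψ c) {c : A → ℤ} (hc : c ∈ Q) : cubD φ c = cubD ψ c := by
  unfold cubD
  refine Finset.sum_congr rfl fun a _ => ?_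
  split_ifs with ha
  · rw [h _ (hQ c hc a ha).1, h _ (hQ c hc a ha).2]
  · rfl

theorem cubT_eq_zero {Q : Set (A → ℤ)} (hQ : FacetClosed Q) (L : List ((A → ℤ) → ZMod 2))
    (sgw : (A → ℤ) → ZMod 2) (hsgw : sgw ∈ L) (k : ZMod 2) (h : ∀ c ∈ Q, sgw c = k) :
    ∀ c ∈ Q, cubT L c = 0 := by
  induction L with
  | nil => simp at hsgw
  | cons τ L ih =>
    intro c hc
    rcases List.mem_cons.1 hsgw with rfl | hsgw
    · show cubD _ c = 0
      rw [cubD_congr hQ (ψ := fun c => cubT L c * k) (fun c hc => by simp only [h c hc]) hc,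
        cubD_mul_const, cubD_cubT, zero_mul]
    · show cubD _ c = 0
      rw [cubD_congr hQ (ψ := fun _ => 0) (fun c hc => by simp only [ih hsgw c hc, zero_mul]) hc,
        cubD_const]

theorem cubT_invariant {Q : Set (A → ℤ)} (hQ : FacetClosed Q) (R : (A → ℤ) → (A → ℤ))
    (hR : ∀ (φ : (A → ℤ) → ZMod 2), ∀ c ∈ Q, cubD φ (R c) = cubD (fun c => φ (R c)) c)
    (L : List ((A → ℤ) → ZMod 2))
    (hL : ∀ sgw ∈ L, ∃ k : ZMod 2, ∀ c ∈ Q, sgw (R c) = sgw c + k) :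
    ∀ c ∈ Q, cubT L (R c) = cubT L c := by
  induction L with
  | nil => intro c _; rfl
  | cons sgw L ih =>
    intro c hc
    have ih' := ih (fun τ hτ => hL τ (List.mem_cons_of_mem _ hτ))
    obtain ⟨k, hk⟩ := hL sgw List.mem_cons_self
    show cubD _ (R c) = cubD _ c
    rw [hR _ c hc, cubD_congr hQ (ψ := fun c => cubT L c * sgw c + cubT L c * k)
      (fun c hc => by simp only [ih' c hc, hk c hc]; ring) hc, cubD_add, cubD_mul_const,
      cubD_cubT, zero_mul, add_zero]

theorem sum_piFinset_update (S : A → Finset ℤ) (a : A) (z : ℤ) (g : (A → ℤ) → ZMod 2) :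
    ∑ c ∈ Fintype.piFinset S, g c =
      ∑ c ∈ Fintype.piFinset (update S a {z}), ∑ v ∈ S a, g (update c a v) := by
  rw [← Finset.sum_product']
  refine Finset.sum_bij' (fun c _ => (update c a z, c a)) (fun p _ => update p.1 a p.2)
    ?_ ?_ ?_ ?_ ?_
  · intro c hc
    rw [Fintype.mem_piFinset] at hc
    simp only [Finset.mem_product, Fintype.mem_piFinset]
    refine ⟨fun b => ?_, hc a⟩
    by_cases hb : b = a
    · subst hb; simp
    · simp [hb, hc b]
  · rintro ⟨c, v⟩ hc
    simp only [Finset.mem_product, Fintype.mem_piFinset] at hc ⊢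
    intro b
    by_cases hb : b = a
    · subst hb; simpa using hc.2
    · have := hc.1 b
      simpa [hb] using this
  · intro c _; simp
  · rintro ⟨c, v⟩ hc
    simp only [Finset.mem_product, Fintype.mem_piFinset] at hc
    have := hc.1 a
    simp only [update_self, Finset.mem_singleton] at this
    simp [← this]
  · intro c _; simp

/-- odd numbers in `[0, 2M]`. -/
def oddsTo (M : ℕ) : Finset ℤ := (Finset.range M).image (fun k : ℕ => (2 * (k : ℤ) + 1))

theorem mem_oddsTo {M : ℕ} {z : ℤ} : z ∈ oddsTo M ↔ Odd z ∧ 0 ≤ z ∧ z ≤ 2 * M := by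
  unfold oddsTo
  simp only [Finset.mem_image, Finset.mem_range]
  constructor
  · rintro ⟨k, hk, rfl⟩
    exact ⟨⟨k, rfl⟩, by omega, by omega⟩
  · rintro ⟨⟨k, rfl⟩, h1, h2⟩
    exact ⟨k.toNat, by omega, by omega⟩

theorem sum_oddsTo (M : ℕ) (ψ : ℤ → ZMod 2) :
    ∑ z ∈ oddsTo M, (ψ (z + 1) + ψ (z - 1)) = ψ 0 + ψ (2 * M) := by
  unfold oddsTo
  rw [Finset.sum_image (by intro a _ b _ h; simp at h; exact h)]
  induction M with
  | zero => simp [CharTwo.add_self_eq_zero]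
  | succ M ih =>
    rw [Finset.sum_range_succ, ih]
    have e1 : (2 * (M : ℤ) + 1 + 1) = 2 * ((M + 1 : ℕ) : ℤ) := by push_cast; ring
    have e2 : (2 * (M : ℤ) + 1 - 1) = 2 * (M : ℤ) := by ring
    rw [e1, e2]
    have := CharTwo.add_self_eq_zero (ψ (2 * (M : ℤ)))
    linear_combination this

theorem card_oddsTo (M : ℕ) : (oddsTo M).card = M := by
  unfold oddsTo
  rw [Finset.card_image_of_injective _ (by intro a b h; simp at h; exact h), Finset.card_range]
end

open Function

/-- The combinatorial number: coefficient of `u^d` in the product of the linear forms in `L`. -/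
def bnum {ι : Type*} [Fintype ι] [DecidableEq ι] : (ι → ℕ) → List (ι → ZMod 2) → ZMod 2
  | d, [] => if d = 0 then 1 else 0
  | d, χ :: L => ∑ i, if 0 < d i then χ i * bnum (update d i (d i - 1)) L else 0

section
variable {ι : Type*} [Fintype ι] [DecidableEq ι] (q : ι → ℕ)

/-- Cells of the product of fundamental domains. -/
def cellFam (d : ι → ℕ) (M : ℕ) : (Σ i, Fin (q i)) → Finset ℤ :=
  fun a => if (a.2 : ℕ) < d a.1 then oddsTo M else {0}

/-- The face relations satisfied by an equivariant sign function. -/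
structure FaceRel (M : ℕ) (sgw : ((Σ i, Fin (q i)) → ℤ) → ZMod 2) (χ : ι → ZMod 2) : Prop where
  top : ∀ (i : ι) (l : Fin (q i)) (c : (Σ i, Fin (q i)) → ℤ), c ⟨i, l⟩ = 0 →
    (∀ l', l < l' → c ⟨i, l'⟩ = 0) → sgw (update c ⟨i, l⟩ (2 * M)) = sgw c + χ i
  side : ∀ (i : ι) (l l' : Fin (q i)) (c : (Σ i, Fin (q i)) → ℤ), (l' : ℕ) = l + 1 →
    c ⟨i, l⟩ = 0 → sgw (update (update c ⟨i, l⟩ (2 * M)) ⟨i, l'⟩ (2 * M - c ⟨i, l'⟩)) = sgw c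

theorem facetClosed_top (i : ι) (l : Fin (q i)) :
    FacetClosed {c : (Σ i, Fin (q i)) → ℤ | c ⟨i, l⟩ = 0 ∧ ∀ l', l < l' → c ⟨i, l'⟩ = 0} := by
  rintro c ⟨h1, h2⟩ a ha
  have hne : ∀ l', l ≤ l' → (⟨i, l'⟩ : Σ i, Fin (q i)) ≠ a := by
    rintro l' hl' rfl
    rcases hl'.eq_or_lt with rfl | hl'
    · rw [h1] at ha; simp at ha
    · rw [h2 _ hl'] at ha; simp at ha
  constructor <;>
  · refine ⟨?_, fun l' hl' => ?_⟩
    · rw [update_of_ne (hne l le_rfl), h1]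
    · rw [update_of_ne (hne l' hl'.le), h2 l' hl']

theorem facetClosed_side {A : Type*} [Fintype A] [DecidableEq A] (a : A) :
    FacetClosed {c : A → ℤ | c a = 0} := by
  intro c h1 b hb
  have hne : a ≠ b := by
    rintro rfl
    have h2 : c a = 0 := h1
    rw [h2] at hb; simp at hb
  constructor <;>
  · show update _ _ _ _ = _
    rw [update_of_ne hne]; exact h1

theorem cubD_top {A : Type*} [Fintype A] [DecidableEq A] (M : ℕ) (a : A)
    (φ : (A → ℤ) → ZMod 2) (c : A → ℤ) (hc : c a = 0) :
    cubD φ (update c a (2 * M)) = cubD (fun c => φ (update c a (2 * M))) c := by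
  unfold cubD
  refine Finset.sum_congr rfl fun b _ => ?_
  by_cases hb : b = a
  · subst hb
    simp [hc]
  · simp only [update_of_ne hb]
    rw [update_comm (Ne.symm hb), update_comm (Ne.symm hb)]

theorem cubD_side {A : Type*} [Fintype A] [DecidableEq A] (M : ℕ) (a a' : A) (haa : a' ≠ a)
    (φ : (A → ℤ) → ZMod 2) (c : A → ℤ) (hc : c a = 0) :
    cubD φ (update (update c a (2 * M)) a' (2 * M - c a')) =
      cubD (fun c => φ (update (update c a (2 * M)) a' (2 * M - c a'))) c := by
  unfold cubD
  refine Finset.sum_congr rfl fun b _ => ?_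
  by_cases hb : b = a
  · subst hb
    simp [hc, Ne.symm haa]
  by_cases hb' : b = a'
  · subst hb'
    have e : Odd (2 * (M : ℤ) - c b) ↔ Odd (c b) := by
      constructor
      · rintro ⟨k, hk⟩; exact ⟨M - k - 1, by omega⟩
      · rintro ⟨k, hk⟩; exact ⟨M - k - 1, by omega⟩
    simp only [update_self, e, update_idem]
    by_cases h : Odd (c b)
    · simp only [h, if_true]
      have e1 : 2 * (M : ℤ) - c b + 1 = 2 * M - (c b - 1) := by ring
      have e2 : 2 * (M : ℤ) - c b - 1 = 2 * M - (c b + 1) := by ring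
      have e3 : ∀ z w : ℤ, update (update (update c b z) a (2 * M)) b w =
          update (update c a (2 * M)) b w := by
        intro z w
        rw [update_comm (Ne.symm hb), update_idem, update_comm hb]
      rw [e1, e2, e3, e3, add_comm]
    · simp [h]
  · simp only [update_of_ne hb', update_of_ne hb, update_of_ne (Ne.symm hb')]
    rw [update_comm (Ne.symm hb'), update_comm (Ne.symm hb'), update_comm (Ne.symm hb),
      update_comm (Ne.symm hb)]

theorem cellFam_pred (d : ι → ℕ) (M : ℕ) (i : ι) (l : Fin (q i)) (hl : (l : ℕ) + 1 = d i) :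
    update (cellFam q d M) ⟨i, l⟩ {0} = cellFam q (update d i (d i - 1)) M := by
  funext a
  by_cases ha : a = ⟨i, l⟩
  · subst ha
    have h1 : ¬ (l : ℕ) < update d i (d i - 1) i := by rw [update_self]; omega
    rw [update_self]
    unfold cellFam
    rw [if_neg h1]
  · rw [update_of_ne ha]
    obtain ⟨i', l'⟩ := a
    unfold cellFam
    by_cases hi : i' = i
    · subst hi
      have : (l' : ℕ) ≠ l := fun h => ha (by rw [Fin.ext h])
      have e : ((l' : ℕ) < d i') ↔ ((l' : ℕ) < update d i' (d i' - 1) i') := by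
        rw [update_self]; omega
      simp only [e]
    · simp only [update_of_ne hi]

theorem sum_cells_eq_bnum (M : ℕ) (hM : Even M)
    (L : List ((((Σ i, Fin (q i)) → ℤ) → ZMod 2) × (ι → ZMod 2)))
    (hL : ∀ p ∈ L, FaceRel q M p.1 p.2) : ∀ d : ι → ℕ, (∀ i, d i ≤ q i) →
    ∑ c ∈ Fintype.piFinset (cellFam q d M), cubT (L.map Prod.fst) c =
      bnum d (L.map Prod.snd) := by
  induction L with
  | nil =>
    intro d hd
    simp only [List.map_nil, cubT, bnum]
    rw [Finset.sum_const, Fintype.card_piFinset]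
    split_ifs with h
    · subst h
      simp [cellFam]
    · obtain ⟨i, hi⟩ : ∃ i, d i ≠ 0 := by
        by_contra! h'
        exact h (funext h')
      rw [nsmul_one, Nat.cast_prod]
      refine Finset.prod_eq_zero (i := ⟨i, ⟨0, by have := hd i; omega⟩⟩) (Finset.mem_univ _) ?_
      simp only [cellFam]
      rw [if_pos (by omega), card_oddsTo]
      exact (ZMod.natCast_eq_zero_iff_even).2 hM
  | cons p L ih =>
    intro d hd
    have hp := hL p List.mem_cons_self
    have hL' : ∀ p ∈ L, FaceRel q M p.1 p.2 := fun p h => hL p (List.mem_cons_of_mem _ h)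
    have ih' := ih hL'
    simp only [List.map_cons, cubT, bnum]
    set T := cubT (L.map Prod.fst) with hT
    set φ : ((Σ i, Fin (q i)) → ℤ) → ZMod 2 := fun c => T c * p.1 c with hφ
    have step1 : ∀ i (l : Fin (q i)), (∑ c ∈ Fintype.piFinset (cellFam q d M),
        if Odd (c ⟨i, l⟩) then φ (update c ⟨i, l⟩ (c ⟨i, l⟩ + 1)) +
          φ (update c ⟨i, l⟩ (c ⟨i, l⟩ - 1)) else 0) =
        if (l : ℕ) + 1 = d i then p.2 i * bnum (update d i (d i - 1)) (L.map Prod.snd) else 0 := by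
      intro i l
      by_cases hl : (l : ℕ) < d i
      · have hfam : cellFam q d M ⟨i, l⟩ = oddsTo M := by simp [cellFam, hl]
        rw [sum_piFinset_update _ ⟨i, l⟩ 0]
        have e1 : ∀ c ∈ Fintype.piFinset (update (cellFam q d M) ⟨i, l⟩ {0}),
            (∑ v ∈ cellFam q d M ⟨i, l⟩,
            if Odd ((update c ⟨i, l⟩ v) ⟨i, l⟩) then
              φ (update (update c ⟨i, l⟩ v) ⟨i, l⟩ ((update c ⟨i, l⟩ v) ⟨i, l⟩ + 1)) +
              φ (update (update c ⟨i, l⟩ v) ⟨i, l⟩ ((update c ⟨i, l⟩ v) ⟨i, l⟩ - 1)) else 0) =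
            φ c + φ (update c ⟨i, l⟩ (2 * M)) := by
          intro c hc
          have hc0 : c ⟨i, l⟩ = 0 := by
            rw [Fintype.mem_piFinset] at hc
            have := hc ⟨i, l⟩
            simpa using this
          have e0 : φ c = φ (update c ⟨i, l⟩ 0) := by
            congr 1; rw [← hc0]; simp
          rw [e0, hfam, ← sum_oddsTo M (fun z => φ (update c ⟨i, l⟩ z))]
          refine Finset.sum_congr rfl fun v hv => ?_
          simp only [update_self, update_idem, (mem_oddsTo.1 hv).1, if_true]
        rw [Finset.sum_congr rfl e1]
        by_cases hl2 : (l : ℕ) + 1 = d i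
        · rw [if_pos hl2, cellFam_pred q d M i l hl2, ← ih' (update d i (d i - 1)) (by
            intro j
            by_cases hj : j = i
            · subst hj; rw [update_self]; have := hd j; omega
            · rw [update_of_ne hj]; exact hd j), Finset.mul_sum]
          refine Finset.sum_congr rfl fun c hc => ?_
          rw [Fintype.mem_piFinset] at hc
          have hz : ∀ l', l ≤ l' → c ⟨i, l'⟩ = 0 := by
            intro l' hl'
            have h := hc ⟨i, l'⟩
            unfold cellFam at h
            have hl'' : (l : ℕ) ≤ l' := hl'
            rw [if_neg (by simp only [update_self]; omega)] at h
            simpa using h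
          have hcQ : c ∈ {c : (Σ i, Fin (q i)) → ℤ |
              c ⟨i, l⟩ = 0 ∧ ∀ l', l < l' → c ⟨i, l'⟩ = 0} :=
            ⟨hz l le_rfl, fun l' h => hz l' h.le⟩
          have hTi : T (update c ⟨i, l⟩ (2 * M)) = T c :=
            cubT_invariant (facetClosed_top q i l) (fun c => update c ⟨i, l⟩ (2 * M))
              (fun φ c hc => cubD_top M ⟨i, l⟩ φ c hc.1) _ (by
                intro sgw hsgw
                obtain ⟨p', hp', rfl⟩ := List.mem_map.1 hsgw
                exact ⟨p'.2 i, fun c hc => (hL' p' hp').top i l c hc.1 hc.2⟩) c hcQ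
          simp only [hφ]
          rw [hTi, hp.top i l c hcQ.1 hcQ.2]
          have := CharTwo.add_self_eq_zero (T c * p.1 c)
          linear_combination this
        · rw [if_neg hl2, Finset.sum_add_distrib]
          have hlq : (l : ℕ) + 1 < q i := by have := hd i; omega
          set l' : Fin (q i) := ⟨l + 1, hlq⟩ with hl'
          have hne : (⟨i, l'⟩ : Σ i, Fin (q i)) ≠ ⟨i, l⟩ := by
            intro h
            have h2 : l' = l := by simpa using h
            have h3 := congrArg Fin.val h2
            simp [hl'] at h3
          set S := update (cellFam q d M) ⟨i, l⟩ {0} with hS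
          have hSl' : S ⟨i, l'⟩ = oddsTo M := by
            rw [hS, update_of_ne hne]
            unfold cellFam
            rw [if_pos]
            simp only [hl']
            omega
          have e2 : ∑ c ∈ Fintype.piFinset S, φ (update c ⟨i, l⟩ (2 * M)) =
              ∑ c ∈ Fintype.piFinset S, φ (update (update c ⟨i, l⟩ (2 * M)) ⟨i, l'⟩
                (2 * M - c ⟨i, l'⟩)) := by
            have hmem : ∀ c ∈ Fintype.piFinset S,
                update c ⟨i, l'⟩ (2 * M - c ⟨i, l'⟩) ∈ Fintype.piFinset S := by
              intro c hc
              rw [Fintype.mem_piFinset] at hc ⊢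
              intro a
              by_cases ha : a = ⟨i, l'⟩
              · subst ha
                have h := hc ⟨i, l'⟩
                rw [hSl', mem_oddsTo] at h
                rw [hSl', mem_oddsTo, update_self]
                refine ⟨?_, by omega, by omega⟩
                obtain ⟨k, hk⟩ := h.1
                exact ⟨M - k - 1, by omega⟩
              · rw [update_of_ne ha]; exact hc a
            refine Finset.sum_bij' (fun c _ => update c ⟨i, l'⟩ (2 * M - c ⟨i, l'⟩))
              (fun c _ => update c ⟨i, l'⟩ (2 * M - c ⟨i, l'⟩)) hmem hmem ?_ ?_ ?_
            · intro c _; simp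
            · intro c _; simp
            · intro c _
              simp only [update_self]
              rw [update_comm hne, update_idem, update_comm (Ne.symm hne)]
              simp
          rw [e2, ← Finset.sum_add_distrib]
          refine Finset.sum_eq_zero fun c hc => ?_
          have hc0 : c ⟨i, l⟩ = 0 := by
            rw [Fintype.mem_piFinset] at hc
            have := hc ⟨i, l⟩
            simpa [hS] using this
          have hTi : T (update (update c ⟨i, l⟩ (2 * M)) ⟨i, l'⟩ (2 * M - c ⟨i, l'⟩)) = T c :=
            cubT_invariant (facetClosed_side (⟨i, l⟩ : Σ i, Fin (q i)))
              (fun c => update (update c ⟨i, l⟩ (2 * M)) ⟨i, l'⟩ (2 * M - c ⟨i, l'⟩))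
              (fun φ c hc => cubD_side M (⟨i, l⟩ : Σ i, Fin (q i)) ⟨i, l'⟩ hne φ c hc) _ (by
                intro sgw hsgw
                obtain ⟨p', hp', rfl⟩ := List.mem_map.1 hsgw
                exact ⟨0, fun c hc => by
                  rw [add_zero]; exact (hL' p' hp').side i l l' c rfl hc⟩) c hc0
          simp only [hφ]
          rw [hTi, hp.side i l l' c rfl hc0]
          exact CharTwo.add_self_eq_zero _
      · rw [if_neg (by omega)]
        refine Finset.sum_eq_zero fun c hc => ?_
        rw [Fintype.mem_piFinset] at hc
        have h := hc ⟨i, l⟩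
        unfold cellFam at h
        rw [if_neg hl, Finset.mem_singleton] at h
        rw [if_neg (by rw [h]; simp)]
    unfold cubD
    rw [Finset.sum_comm, Fintype.sum_sigma]
    refine Finset.sum_congr rfl fun i _ => ?_
    simp only [step1]
    split_ifs with hdi
    · have hq : d i - 1 < q i := by have := hd i; omega
      rw [Finset.sum_eq_single (⟨d i - 1, hq⟩ : Fin (q i))]
      · rw [if_pos (by simp; omega)]
      · intro l _ hne
        rw [if_neg]
        intro h
        apply hne
        apply Fin.ext
        simp; omega
      · simp
    · refine Finset.sum_eq_zero fun l _ => ?_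
      rw [if_neg (by omega)]
end

open Function

section
variable {k : ℕ}

/-- Spherical coordinates. -/
noncomputable def sph (x : Fin k → ℝ) : Fin (k + 1) → ℝ :=
  Fin.cons (∏ l, Real.cos (Real.pi * x l))
    (fun l => Real.sin (Real.pi * x l) * ∏ l' ∈ Finset.Ioi l, Real.cos (Real.pi * x l'))

theorem sph_continuous : Continuous (sph (k := k)) := by
  refine continuous_pi fun m => ?_
  refine Fin.cases ?_ (fun l => ?_) m
  · simp only [sph, Fin.cons_zero]; fun_prop
  · simp only [sph, Fin.cons_succ]; fun_prop

theorem sph_ne_zero (x : Fin k → ℝ) : sph x ≠ 0 := by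
  intro h
  by_cases hc : ∀ l, Real.cos (Real.pi * x l) ≠ 0
  · have h0 := congrFun h 0
    simp only [sph, Fin.cons_zero] at h0
    exact (Finset.prod_ne_zero_iff.2 fun l _ => hc l) h0
  · push Not at hc
    obtain ⟨l0, hl0⟩ := hc
    obtain ⟨l, hl, hmax⟩ := (Finset.univ.filter fun l => Real.cos (Real.pi * x l) = 0).exists_max_image
      id ⟨l0, by simp [hl0]⟩
    have h0 := congrFun h l.succ
    simp only [sph, Fin.cons_succ] at h0
    have hl' : Real.cos (Real.pi * x l) = 0 := by simpa using hl
    have hs : Real.sin (Real.pi * x l) ≠ 0 := by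
      intro hs
      have := Real.sin_sq_add_cos_sq (Real.pi * x l)
      rw [hs, hl'] at this
      norm_num at this
    refine (mul_ne_zero hs (Finset.prod_ne_zero_iff.2 fun m hm h1 => ?_)) h0
    have h2 := hmax m (by simp [h1])
    simp at hm
    exact absurd h2 (not_le.2 hm)

theorem sph_top (x : Fin k → ℝ) (l : Fin k) (h0 : x l = 0) (h1 : ∀ l', l < l' → x l' = 0) :
    sph (update x l 1) = - sph x := by
  have key : ∀ S : Finset (Fin k), ∏ m ∈ S, Real.cos (Real.pi * update x l 1 m) =
      (∏ m ∈ S, Real.cos (Real.pi * x m)) * (if l ∈ S then -1 else 1) := by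
    intro S
    rw [← Finset.prod_ite_eq' S l (fun _ => (-1 : ℝ)), ← Finset.prod_mul_distrib]
    refine Finset.prod_congr rfl fun m _ => ?_
    by_cases hm : m = l
    · subst hm; simp [h0]
    · simp [hm]
  funext m
  refine Fin.cases ?_ (fun m => ?_) m
  · simp only [sph, Fin.cons_zero, Pi.neg_apply, key]; simp
  · simp only [sph, Fin.cons_succ, Pi.neg_apply, key]
    rcases lt_trichotomy m l with h | h | h
    · simp [h, h.ne]
    · subst h; simp [h0]
    · simp [h.ne', h1 m h]

theorem sph_side (x : Fin k → ℝ) (l l' : Fin k) (hl : (l' : ℕ) = l + 1) (h0 : x l = 0) :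
    sph (update (update x l 1) l' (1 - x l')) = sph x := by
  have hne : l' ≠ l := by rintro rfl; omega
  have key : ∀ S : Finset (Fin k), ∏ m ∈ S, Real.cos (Real.pi * update (update x l 1) l' (1 - x l') m) =
      (∏ m ∈ S, Real.cos (Real.pi * x m)) * ((if l ∈ S then -1 else 1) * (if l' ∈ S then -1 else 1)) := by
    intro S
    rw [← Finset.prod_ite_eq' S l (fun _ => (-1 : ℝ)), ← Finset.prod_ite_eq' S l' (fun _ => (-1 : ℝ)),
      ← Finset.prod_mul_distrib, ← Finset.prod_mul_distrib]
    refine Finset.prod_congr rfl fun m _ => ?_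
    by_cases hm : m = l'
    · subst hm
      simp [hne, mul_sub, Real.cos_pi_sub]
    · by_cases hm' : m = l
      · subst hm'; simp [h0, hm]
      · simp [hm, hm']
  funext m
  refine Fin.cases ?_ (fun m => ?_) m
  · simp only [sph, Fin.cons_zero, key]; simp
  · simp only [sph, Fin.cons_succ, key]
    rcases lt_trichotomy m l with h | h | h
    · have h2 : m < l' := by
        rw [Fin.lt_def] at h ⊢; omega
      simp [h, h.ne, h2, h2.ne]
    · subst h
      simp [h0, Ne.symm hne]
    · by_cases h3 : m = l'
      · subst h3
        have : ¬ (m < l) := not_lt.2 h.le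
        simp [mul_sub, Real.sin_pi_sub, this]
      · have h4 : ¬ (m < l') := by
          rw [Fin.lt_def] at h ⊢; omega
        have : ¬ (m < l) := not_lt.2 h.le
        simp [h3, h4, this, h.ne']

/-- Orientation bit of a vector. -/
noncomputable def tauBit (w : Fin k → ℝ) : ZMod 2 :=
  open Classical in if toLex w < 0 then 1 else 0

theorem tauBit_neg (w : Fin k → ℝ) (hw : w ≠ 0) : tauBit (-w) = tauBit w + 1 := by
  unfold tauBit
  have hn : toLex (-w) = - toLex w := rfl
  have hw' : toLex w ≠ 0 := fun h => hw (congrArg ofLex h)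
  rw [hn]
  have e : (-toLex w < 0) ↔ ¬ (toLex w < 0) := by
    constructor
    · intro h h2
      exact lt_asymm (neg_lt_zero.1 h) h2
    · intro h
      exact neg_lt_zero.2 (lt_of_le_of_ne (not_lt.1 h) (Ne.symm hw'))
  by_cases h : toLex w < 0
  · rw [if_neg (by rw [e]; exact not_not.2 h), if_pos h]; decide
  · rw [if_pos (e.2 h), if_neg h]; decide
end

/-- products of punctured Euclidean spaces. -/
abbrev PSp {ι : Type*} (q : ι → ℕ) := (i : ι) → {w : Fin (q i + 1) → ℝ // w ≠ 0}

section
variable {ι : Type*} [Fintype ι] [DecidableEq ι] (q : ι → ℕ)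

/-- flip the sign of one vector. -/
def flipAt (i : ι) (v : PSp q) : PSp q := update v i ⟨-(v i).1, neg_ne_zero.2 (v i).2⟩

/-- lattice embedding -/
noncomputable def sphE (x : (Σ i, Fin (q i)) → ℝ) : PSp q := fun i =>
  ⟨sph fun l => x ⟨i, l⟩, sph_ne_zero _⟩

theorem sphE_continuous : Continuous (sphE q) := by
  refine continuous_pi fun i => ?_
  refine Continuous.subtype_mk ?_ _
  exact sph_continuous.comp (by fun_prop)

theorem sphE_top (i : ι) (l : Fin (q i)) (x : (Σ i, Fin (q i)) → ℝ) (h0 : x ⟨i, l⟩ = 0)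
    (h1 : ∀ l', l < l' → x ⟨i, l'⟩ = 0) :
    sphE q (update x ⟨i, l⟩ 1) = flipAt q i (sphE q x) := by
  funext j
  by_cases hj : j = i
  · subst hj
    simp only [flipAt, update_self]
    apply Subtype.ext
    simp only [sphE]
    rw [← sph_top _ l h0 h1]
    congr 1
    funext m
    by_cases hm : m = l
    · subst hm; simp
    · rw [update_of_ne hm, update_of_ne]; simpa using hm
  · simp only [flipAt, update_of_ne hj]
    apply Subtype.ext
    simp only [sphE]
    congr 1
    funext m
    rw [update_of_ne]
    intro h; exact hj (congrArg Sigma.fst h)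

theorem sphE_side (i : ι) (l l' : Fin (q i)) (x : (Σ i, Fin (q i)) → ℝ) (hl : (l' : ℕ) = l + 1)
    (h0 : x ⟨i, l⟩ = 0) :
    sphE q (update (update x ⟨i, l⟩ 1) ⟨i, l'⟩ (1 - x ⟨i, l'⟩)) = sphE q x := by
  funext j
  apply Subtype.ext
  simp only [sphE]
  by_cases hj : j = i
  · subst hj
    rw [← sph_side (fun l => x ⟨j, l⟩) l l' hl h0]
    congr 1
    funext m
    by_cases hm : m = l'
    · subst hm; simp
    · rw [update_of_ne hm, update_of_ne (by simpa using hm)]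
      by_cases hm : m = l
      · subst hm; simp
      · rw [update_of_ne hm, update_of_ne]; simpa using hm
  · congr 1
    funext m
    rw [update_of_ne, update_of_ne]
    · intro h; exact hj (congrArg Sigma.fst h)
    · intro h; exact hj (congrArg Sigma.fst h)

/-- sign bit of an equivariant function -/
noncomputable def sgnBit (f : C(PSp q, ℝ)) (χ : ι → ZMod 2) (v : PSp q) : ZMod 2 :=
  open Classical in
  if 0 < f v then 0 else if f v < 0 then 1 else ∑ i, χ i * tauBit (v i).1

/-- equivariance with respect to a character -/
def EqvChar (f : C(PSp q, ℝ)) (χ : ι → ZMod 2) : Prop :=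
  ∀ i v, f (flipAt q i v) = (if χ i = 0 then 1 else -1) * f v

theorem sgnBit_flip (f : C(PSp q, ℝ)) (χ : ι → ZMod 2) (hf : EqvChar q f χ) (i : ι) (v : PSp q) :
    sgnBit q f χ (flipAt q i v) = sgnBit q f χ v + χ i := by
  have ht : ∑ j, χ j * tauBit (flipAt q i v j).1 = (∑ j, χ j * tauBit (v j).1) + χ i := by
    have : χ i = ∑ j, if j = i then χ j else 0 := by simp
    conv_rhs => rw [this]
    rw [← Finset.sum_add_distrib]
    refine Finset.sum_congr rfl fun j _ => ?_
    by_cases hj : j = i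
    · subst hj
      simp only [flipAt, update_self, if_true]
      rw [tauBit_neg _ (v j).2]; ring
    · simp [flipAt, hj]
  unfold sgnBit
  rw [ht, hf i v]
  by_cases h : χ i = 0
  · simp [h]
  · have h1 : χ i = 1 := by
      generalize χ i = z at h
      revert h; revert z; decide
    rw [if_neg h, h1]
    rcases lt_trichotomy (f v) 0 with h2 | h2 | h2
    · simp [h2, h2.le, not_lt.2 h2.le]; decide
    · simp [h2]
    · simp [h2, h2.le, not_lt.2 h2.le]

theorem borsukUlam (L : List (C(PSp q, ℝ) × (ι → ZMod 2))) (hL : ∀ p ∈ L, EqvChar q p.1 p.2)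
    (hne : ∀ v, ∃ p ∈ L, p.1 v ≠ 0) (d : ι → ℕ) (hd : ∀ i, d i ≤ q i) :
    bnum d (L.map Prod.snd) = 0 := by
  classical
  -- Lebesgue number
  let K : Set ((Σ i, Fin (q i)) → ℝ) := Set.Icc 0 1
  have hK : IsCompact K := isCompact_Icc
  let cov : {p // p ∈ L} × Bool → Set ((Σ i, Fin (q i)) → ℝ) := fun pb =>
    if pb.2 then {x | 0 < pb.1.1.1 (sphE q x)} else {x | pb.1.1.1 (sphE q x) < 0}
  have hcov : ∀ pb, IsOpen (cov pb) := by
    rintro ⟨p, b⟩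
    have hc : Continuous fun x => p.1.1 (sphE q x) := p.1.1.continuous.comp (sphE_continuous q)
    cases b
    · exact isOpen_lt hc continuous_const
    · exact isOpen_lt continuous_const hc
  obtain ⟨δ, hδ, hleb⟩ := lebesgue_number_lemma_of_metric hK hcov (by
    intro x _
    obtain ⟨p, hp, h⟩ := hne (sphE q x)
    rw [Set.mem_iUnion]
    rcases lt_or_gt_of_ne h with h | h
    · exact ⟨(⟨p, hp⟩, false), h⟩
    · exact ⟨(⟨p, hp⟩, true), h⟩)
  obtain ⟨N, hN⟩ := exists_nat_gt (1 / δ)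
  let M : ℕ := 2 * (N + 1)
  have hM : Even M := ⟨N + 1, by omega⟩
  have hM0 : (0 : ℝ) < 2 * M := by simp only [M]; positivity
  have hMδ : 1 / (2 * M : ℝ) < δ := by
    rw [div_lt_iff₀ hM0]
    rw [div_lt_iff₀ hδ] at hN
    have : (N : ℝ) ≤ 2 * M := by simp only [M]; push_cast; linarith [Nat.cast_nonneg (α := ℝ) N]
    nlinarith
  let sc : ((Σ i, Fin (q i)) → ℤ) → ((Σ i, Fin (q i)) → ℝ) := fun c a => (c a : ℝ) / (2 * M)
  let L' : List ((((Σ i, Fin (q i)) → ℤ) → ZMod 2) × (ι → ZMod 2)) :=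
    L.map fun p => (fun c => sgnBit q p.1 p.2 (sphE q (sc c)), p.2)
  have scu : ∀ c a (z : ℤ), sc (update c a z) = update (sc c) a ((z : ℝ) / (2 * M)) := by
    intro c a z
    funext b
    by_cases hb : b = a
    · subst hb; simp [sc]
    · simp [sc, hb]
  have hrel : ∀ p ∈ L', FaceRel q M p.1 p.2 := by
    intro p' hp'
    obtain ⟨p, hp, rfl⟩ := List.mem_map.1 hp'
    constructor
    · intro i l c h0 h1
      show sgnBit q p.1 p.2 _ = sgnBit q p.1 p.2 _ + p.2 i
      rw [scu]
      have : (((2 * M : ℤ)) : ℝ) / (2 * M) = 1 := by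
        push_cast; exact div_self hM0.ne'
      rw [this, sphE_top q i l (sc c) (by simp [sc, h0]) (fun l' hl' => by simp [sc, h1 l' hl'])]
      exact sgnBit_flip q _ _ (hL p hp) i _
    · intro i l l' c hl h0
      show sgnBit q p.1 p.2 _ = sgnBit q p.1 p.2 _
      rw [scu, scu]
      have e1 : (((2 * M : ℤ)) : ℝ) / (2 * M) = 1 := by
        push_cast; exact div_self hM0.ne'
      have e2 : (((2 * M - c ⟨i, l'⟩ : ℤ)) : ℝ) / (2 * M) = 1 - sc c ⟨i, l'⟩ := by
        simp only [sc]
        rw [eq_sub_iff_add_eq, ← add_div]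
        push_cast
        rw [sub_add_cancel]; exact div_self hM0.ne'
      rw [e1, e2, sphE_side q i l l' (sc c) hl (by simp [sc, h0])]
  have hfin := sum_cells_eq_bnum q M hM L' hrel d hd
  have hsnd : L'.map Prod.snd = L.map Prod.snd := by
    simp [L', List.map_map]
  rw [hsnd] at hfin
  rw [← hfin]
  refine Finset.sum_eq_zero fun c hc => ?_
  rw [Fintype.mem_piFinset] at hc
  have hcb : ∀ a, 0 ≤ c a ∧ c a ≤ 2 * M := by
    intro a
    have h := hc a
    unfold cellFam at h
    split_ifs at h
    · exact (mem_oddsTo.1 h).2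
    · rw [Finset.mem_singleton] at h; omega
  have hcK : sc c ∈ K := by
    refine ⟨fun a => ?_, fun a => ?_⟩
    · simp only [sc, Pi.zero_apply]
      have : (0 : ℝ) ≤ c a := by exact_mod_cast (hcb a).1
      positivity
    · simp only [sc, Pi.one_apply]
      rw [div_le_one hM0]
      exact_mod_cast (hcb a).2
  obtain ⟨⟨⟨p, hp⟩, b⟩, hpb⟩ := hleb _ hcK
  let Q : Set ((Σ i, Fin (q i)) → ℤ) := {e | ∀ a, |e a - c a| ≤ 1 ∧ (Odd (e a) → e a = c a)}
  have hQ : FacetClosed Q := by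
    intro e he a ha
    have he' : ∀ a, |e a - c a| ≤ 1 ∧ (Odd (e a) → e a = c a) := he
    have h1 := (he' a).2 ha
    constructor
    · intro b
      by_cases hb : b = a
      · subst hb
        rw [update_self]
        refine ⟨by rw [h1]; simp, fun h => ?_⟩
        exact absurd h (by rw [Int.not_odd_iff_even]; exact ha.add_odd odd_one)
      · rw [update_of_ne hb]; exact he' b
    · intro b
      by_cases hb : b = a
      · subst hb
        rw [update_self]
        refine ⟨by rw [h1]; simp, fun h => ?_⟩
        exact absurd h (by rw [Int.not_odd_iff_even]; exact ha.sub_odd odd_one)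
      · rw [update_of_ne hb]; exact he' b
  have hball : ∀ e ∈ Q, sc e ∈ cov (⟨p, hp⟩, b) := by
    intro e he
    have he' : ∀ a, |e a - c a| ≤ 1 ∧ (Odd (e a) → e a = c a) := he
    apply hpb
    rw [Metric.mem_ball, dist_pi_lt_iff hδ]
    intro a
    rw [Real.dist_eq]
    simp only [sc]
    rw [← sub_div, abs_div, abs_of_pos hM0]
    refine lt_of_le_of_lt ?_ hMδ
    gcongr
    exact_mod_cast (he' a).1
  refine cubT_eq_zero hQ (L'.map Prod.fst) (fun c => sgnBit q p.1 p.2 (sphE q (sc c))) ?_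
    (if b then 0 else 1) ?_ c (fun a => ⟨by simp, fun _ => rfl⟩)
  · simp only [L', List.map_map, List.mem_map]
    exact ⟨p, hp, rfl⟩
  · intro e he
    have h := hball e he
    cases b
    · have h' : p.1 (sphE q (sc e)) < 0 := h
      simp [sgnBit, h', not_lt.2 h'.le]
    · have h' : 0 < p.1 (sphE q (sc e)) := h
      simp [sgnBit, h']
end

open Function

section
variable {ι : Type*} [Fintype ι] [DecidableEq ι]

/-- the character `e_i + e_j` -/
def pch (i j : ι) : ι → ZMod 2 := Pi.single i 1 + Pi.single j 1

theorem bnum_pair (d : ι → ℕ) (i j : ι) (hij : i ≠ j) (L : List (ι → ZMod 2)) :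
    bnum d (pch i j :: L) = (if 0 < d i then bnum (update d i (d i - 1)) L else 0) +
      (if 0 < d j then bnum (update d j (d j - 1)) L else 0) := by
  simp only [bnum]
  have : ∀ x, (if 0 < d x then pch i j x * bnum (update d x (d x - 1)) L else 0) =
      (if x = i then (if 0 < d x then bnum (update d x (d x - 1)) L else 0) else 0) +
      (if x = j then (if 0 < d x then bnum (update d x (d x - 1)) L else 0) else 0) := by
    intro x
    by_cases h1 : x = i
    · subst h1
      simp [pch, hij]
    · by_cases h2 : x = j
      · subst h2; simp [pch, h1]
      · simp [pch, h1, h2]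
  simp only [this]
  rw [Finset.sum_add_distrib]
  simp

theorem bnum_forced (i j : ι) (hij : i ≠ j) (L : List (ι → ZMod 2)) (c : ℕ) :
    ∀ d : ι → ℕ, d i = 0 → c ≤ d j →
    bnum d (List.replicate c (pch i j) ++ L) = bnum (update d j (d j - c)) L := by
  induction c with
  | zero => intro d _ _; simp
  | succ c ih =>
    intro d h0 hc
    rw [List.replicate_succ, List.cons_append, bnum_pair _ _ _ hij, if_neg (by omega),
      if_pos (by omega), zero_add, ih]
    · simp only [update_self, update_idem]
      congr 2; omega
    · rw [update_of_ne hij, h0]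
    · rw [update_self]; omega

theorem bnum_forced_list {J : Type*} (ψ φ : J → ι) (hφ : Injective φ)
    (hne : ∀ j j', ψ j ≠ φ j') (c : ℕ) (L : List (ι → ZMod 2)) (js : List J) :
    js.Nodup → ∀ d d' : ι → ℕ, (∀ j ∈ js, d (ψ j) = 0) → (∀ j ∈ js, c ≤ d (φ j)) →
    (∀ j ∈ js, d' (φ j) = d (φ j) - c) → (∀ i, (∀ j ∈ js, i ≠ φ j) → d' i = d i) →
    bnum d (js.flatMap (fun j => List.replicate c (pch (ψ j) (φ j))) ++ L) = bnum d' L := by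
  induction js with
  | nil =>
    intro _ d d' _ _ _ h
    have : d' = d := funext fun i => h i (by simp)
    simp [this]
  | cons j js ih =>
    intro hnd d d' h0 hc h1 h2
    rw [List.nodup_cons] at hnd
    rw [List.flatMap_cons, List.append_assoc, bnum_forced _ _ (hne j j) _ _ _ (h0 j List.mem_cons_self)
      (hc j List.mem_cons_self)]
    have hjj : ∀ j' ∈ js, φ j' ≠ φ j := fun j' hj' h => hnd.1 (hφ h ▸ hj')
    apply ih hnd.2
    · intro j' hj'
      rw [update_of_ne (hne _ _)]; exact h0 j' (List.mem_cons_of_mem _ hj')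
    · intro j' hj'
      rw [update_of_ne (hjj j' hj')]; exact hc j' (List.mem_cons_of_mem _ hj')
    · intro j' hj'
      rw [update_of_ne (hjj j' hj')]; exact h1 j' (List.mem_cons_of_mem _ hj')
    · intro i hi
      by_cases hij : i = φ j
      · subst hij; rw [update_self]; exact h1 j List.mem_cons_self
      · rw [update_of_ne hij]
        refine h2 i ?_
        intro j' hj'
        rcases List.mem_cons.1 hj' with rfl | hj'
        · exact hij
        · exact hi j' hj'

theorem bnum_binom (i j : ι) (hij : i ≠ j) (L : List (ι → ZMod 2)) (N : ℕ) :
    ∀ (a b : ℕ) (d : ι → ℕ), a + b = N → d i = a → d j = b →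
    bnum d (List.replicate N (pch i j) ++ L) =
      (N.choose a : ZMod 2) * bnum (update (update d i 0) j 0) L := by
  induction N with
  | zero =>
    intro a b d h hi hj
    have ha : a = 0 := by omega
    have hb : b = 0 := by omega
    subst ha; subst hb
    have : update (update d i 0) j 0 = d := by
      rw [← hi, update_eq_self, hi, ← hj, update_eq_self]
    simp [this]
  | succ N ih =>
    intro a b d h hi hj
    rw [List.replicate_succ, List.cons_append, bnum_pair _ _ _ hij]
    have e1 : ∀ z, update (update (update d i z) i 0) j 0 = update (update d i 0) j 0 := by
      intro z; rw [update_idem]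
    have e2 : ∀ z, update (update (update d j z) i 0) j 0 = update (update d i 0) j 0 := by
      intro z; rw [update_comm (Ne.symm hij), update_idem]
    rcases a with _ | a
    · rw [if_neg (by omega), if_pos (by omega), zero_add, ih 0 (b - 1) _ (by omega)
        (by rw [update_of_ne hij, hi]) (by rw [update_self]; omega), e2]
      simp
    · rw [if_pos (by omega), ih a b _ (by omega) (by rw [update_self]; omega)
        (by rw [update_of_ne (Ne.symm hij), hj]), e1]
      rcases b with _ | b
      · rw [if_neg (by omega)]
        have : a = N := by omega
        subst this; simp
      · rw [if_pos (by omega), ih (a + 1) b _ (by omega) (by rw [update_of_ne hij, hi])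
          (by rw [update_self]; omega), e2, Nat.choose_succ_succ]
        push_cast; ring
end

theorem choose_odd (t : ℕ) : ((2 ^ (t + 1) - 1).choose (2 ^ t) : ZMod 2) = 1 := by
  have key : ∀ k, k ≤ 2 ^ (t + 1) - 1 → ((2 ^ (t + 1) - 1).choose k : ZMod 2) = 1 := by
    intro k
    induction k with
    | zero => simp
    | succ k ih =>
      intro hk
      have h1 := ih (by omega)
      have hpos : 0 < 2 ^ (t + 1) := by positivity
      have h2 : 2 ∣ (2 ^ (t + 1)).choose (k + 1) :=
        Nat.Prime.dvd_choose_pow Nat.prime_two (by omega) (by omega)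
      have h3 : (((2 ^ (t + 1)).choose (k + 1) : ℕ) : ZMod 2) = 0 := by
        rw [ZMod.natCast_eq_zero_iff]; exact h2
      obtain ⟨N, hN⟩ : ∃ N, 2 ^ (t + 1) = N + 1 := ⟨2 ^ (t + 1) - 1, by omega⟩
      rw [hN] at h3 h1 ⊢
      rw [Nat.choose_succ_succ] at h3
      simp only [Nat.add_sub_cancel] at h1 ⊢
      push_cast at h3
      rw [h1] at h3
      generalize ((N.choose (k + 1) : ℕ) : ZMod 2) = z at h3
      revert h3; revert z; decide
  apply key
  have : 0 < 2 ^ t := by positivity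
  rw [pow_succ]; omega

/-- character of a motion planning type -/
def tch {n : ℕ} : Fin (n + 2) ⊕ Fin (n + 2) → (Fin (n + 2) ⊕ Fin (n + 2) → ZMod 2)
  | Sum.inl j => pch (Sum.inl 0) (Sum.inl j)
  | Sum.inr j => pch (Sum.inr 0) (Sum.inr j)

/-- first list of types -/
def listT1 (n s : ℕ) : List (Fin (n + 2) ⊕ Fin (n + 2)) :=
  (List.finRange (n + 1)).flatMap fun j => List.replicate s (Sum.inr j.succ)

/-- second list of types -/
def listT2 (n t : ℕ) : List (Fin (n + 2) ⊕ Fin (n + 2)) :=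
  List.replicate (2 ^ (t + 1) - 1) (Sum.inl 1) ++
    (List.finRange n).flatMap fun j => List.replicate (2 ^ t - 1) (Sum.inl j.succ.succ)

/-- constraint characters -/
def listC (n : ℕ) : List (Fin (n + 2) ⊕ Fin (n + 2) → ZMod 2) :=
  (List.finRange (n + 2)).map fun j => pch (Sum.inr j) (Sum.inl j)

theorem listT1_length (n s : ℕ) : (listT1 n s).length = (n + 1) * s := by
  simp [listT1, List.length_flatMap]

theorem listT2_length (n t : ℕ) : (listT2 n t).length = 2 ^ (t + 1) - 1 + n * (2 ^ t - 1) := by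
  simp [listT2, List.length_flatMap]

/-- the multidegree -/
def degD (n s t : ℕ) : Fin (n + 2) ⊕ Fin (n + 2) → ℕ :=
  Sum.elim (Fin.cons (2 ^ t + 1) (fun _ => 2 ^ t)) (Fin.cons 0 (fun _ => s))

theorem bnum_main (n s t : ℕ) :
    bnum (degD n s t) ((listT1 n s).map tch ++ listC n ++ (listT2 n t).map tch) = 1 := by
  have hpos : 0 < 2 ^ t := by positivity
  have e1 : (listT1 n s).map tch = (List.finRange (n + 1)).flatMap fun j =>
      List.replicate s (pch (Sum.inr 0 : Fin (n + 2) ⊕ Fin (n + 2)) (Sum.inr j.succ)) := by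
    simp [listT1, List.map_flatMap, tch]
  have e2 : listC n = (List.finRange (n + 2)).flatMap fun j =>
      List.replicate 1 (pch (Sum.inr j : Fin (n + 2) ⊕ Fin (n + 2)) (Sum.inl j)) := by
    simp [listC, List.flatMap_singleton']
    rw [List.map_eq_flatMap]
  have e3 : (listT2 n t).map tch = List.replicate (2 ^ (t + 1) - 1)
      (pch (Sum.inl 0 : Fin (n + 2) ⊕ Fin (n + 2)) (Sum.inl 1)) ++
      ((List.finRange n).flatMap (fun j =>
      List.replicate (2 ^ t - 1) (pch (Sum.inl 0 : Fin (n + 2) ⊕ Fin (n + 2))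
        (Sum.inl j.succ.succ))) ++ []) := by
    simp [listT2, List.map_flatMap, tch]
  rw [e1, e2, e3, List.append_assoc]
  let d1 : Fin (n + 2) ⊕ Fin (n + 2) → ℕ := Sum.elim (Fin.cons (2 ^ t + 1) (fun _ => 2 ^ t)) 0
  let d2 : Fin (n + 2) ⊕ Fin (n + 2) → ℕ := Sum.elim (Fin.cons (2 ^ t) (fun _ => 2 ^ t - 1)) 0
  rw [bnum_forced_list (fun _ => Sum.inr 0) (fun j : Fin (n + 1) => Sum.inr j.succ)
    (fun a b h => by simpa using h) (fun j j' => by simp [(Fin.succ_ne_zero j').symm]) s _ _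
    (List.nodup_finRange _) _ d1]
  rotate_left
  · intro j _; simp [degD]
  · intro j _; simp [degD]
  · intro j _; simp [degD, d1]
  · rintro (i | i) hi
    · simp [degD, d1]
    · refine Fin.cases (fun _ => by simp [degD, d1]) (fun i hi => ?_) i hi
      exact absurd rfl (hi i (List.mem_finRange i))
  rw [bnum_forced_list (fun j => Sum.inr j) (fun j : Fin (n + 2) => Sum.inl j)
    (fun a b h => by simpa using h) (fun j j' => by simp) 1 _ _
    (List.nodup_finRange _) _ d2]
  rotate_left
  · intro j _; simp [d1]
  · intro j _
    refine Fin.cases ?_ (fun j => ?_) j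
    · simp [d1]
    · simp [d1]; omega
  · intro j _
    refine Fin.cases ?_ (fun j => ?_) j
    · simp [d1, d2]
    · simp [d1, d2]
  · rintro (i | i) hi
    · exact absurd rfl (hi i (List.mem_finRange i))
    · simp [d1, d2]
  have h01 : (Sum.inl 0 : Fin (n + 2) ⊕ Fin (n + 2)) ≠ Sum.inl 1 := by simp
  rw [bnum_binom (Sum.inl 0) (Sum.inl 1) h01 _ _ (2 ^ t) (2 ^ t - 1) d2 (by rw [pow_succ]; omega)
    (by simp [d2]) (by
      have : (1 : Fin (n + 2)) = Fin.succ 0 := rfl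
      simp only [d2, Sum.elim_inl]
      rw [this, Fin.cons_succ]), choose_odd, one_mul]
  rw [bnum_forced_list (fun _ => Sum.inl 0) (fun j : Fin n => Sum.inl j.succ.succ)
    (fun a b h => by simpa using h) (fun j j' => by simp [(Fin.succ_ne_zero j'.succ).symm])
    (2 ^ t - 1) _ _
    (List.nodup_finRange _) _ 0]
  · simp [bnum]
  · intro j _
    rw [update_of_ne h01, update_self]
  · intro j _
    have h2 : (j.succ.succ : Fin (n + 2)) ≠ 1 := by
      intro h; have := congrArg Fin.val h; simp at this
    rw [update_of_ne (by simpa using h2), update_of_ne (by simp)]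
    simp [d2]
  · intro j _
    have h2 : (j.succ.succ : Fin (n + 2)) ≠ 1 := by
      intro h; have := congrArg Fin.val h; simp at this
    rw [update_of_ne (by simpa using h2), update_of_ne (by simp)]
    simp [d2]
  · rintro (i | i) hi
    · by_cases h1 : i = 1
      · subst h1; simp
      · rw [update_of_ne (by simpa using h1)]
        by_cases h0 : i = 0
        · subst h0; simp
        · obtain ⟨j, rfl⟩ := Fin.exists_succ_eq.2 h0
          have hj : j ≠ 0 := by rintro rfl; exact h1 rfl
          obtain ⟨k, rfl⟩ := Fin.exists_succ_eq.2 hj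
          exact absurd rfl (hi k (List.mem_finRange k))
    · simp [d2]

open Function
open scoped unitInterval

/-- real projective space -/
abbrev RPn (k : ℕ) := Projectivization ℝ (Fin (k + 1) → ℝ)

section
variable {k : ℕ}

/-- quotient map -/
noncomputable def pmk (v : {w : Fin (k + 1) → ℝ // w ≠ 0}) : RPn k := Projectivization.mk ℝ v.1 v.2

theorem pmk_isQuotientMap : Topology.IsQuotientMap (pmk (k := k)) :=
  isQuotientMap_quotient_mk' (s := projectivizationSetoid ℝ (Fin (k + 1) → ℝ))

theorem pmk_continuous : Continuous (pmk (k := k)) := pmk_isQuotientMap.continuous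

theorem pmk_surj : Surjective (pmk (k := k)) := pmk_isQuotientMap.surjective

theorem pmk_eq_iff (v w : {w : Fin (k + 1) → ℝ // w ≠ 0}) :
    pmk v = pmk w ↔ ∃ a : ℝ, a ≠ 0 ∧ v.1 = a • w.1 := by
  unfold pmk
  rw [Projectivization.mk_eq_mk_iff']
  constructor
  · rintro ⟨a, ha⟩
    refine ⟨a, ?_, ha.symm⟩
    rintro rfl
    exact v.2 (by rw [← ha, zero_smul])
  · rintro ⟨a, _, ha⟩
    exact ⟨a, ha.symm⟩

theorem dot_self_ne (v : {w : Fin (k + 1) → ℝ // w ≠ 0}) : v.1 ⬝ᵥ v.1 ≠ 0 := fun h =>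
  v.2 (dotProduct_self_eq_zero.1 h)

theorem dot_self_pos (v : {w : Fin (k + 1) → ℝ // w ≠ 0}) : 0 < v.1 ⬝ᵥ v.1 := by
  refine lt_of_le_of_ne ?_ (Ne.symm (dot_self_ne v))
  exact Finset.sum_nonneg fun i _ => mul_self_nonneg _

/-- projection matrix of a line -/
noncomputable def pm (p : RPn k) : Matrix (Fin (k + 1)) (Fin (k + 1)) ℝ :=
  fun a b => p.rep a * p.rep b / (p.rep ⬝ᵥ p.rep)

theorem pm_pmk (v : {w : Fin (k + 1) → ℝ // w ≠ 0}) (a b : Fin (k + 1)) :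
    pm (pmk v) a b = v.1 a * v.1 b / (v.1 ⬝ᵥ v.1) := by
  obtain ⟨c, hc⟩ := Projectivization.exists_smul_eq_mk_rep ℝ v.1 v.2
  unfold pm
  have hc' : (pmk v).rep = (c : ℝ) • v.1 := hc.symm
  have h0 := dot_self_ne v
  have hc0 : (c : ℝ) ≠ 0 := c.ne_zero
  rw [hc']
  simp only [Pi.smul_apply, smul_eq_mul, smul_dotProduct, dotProduct_smul]
  field_simp

theorem pm_continuous : Continuous (pm (k := k)) := by
  rw [pmk_isQuotientMap.continuous_iff]
  refine continuous_pi fun a => continuous_pi fun b => ?_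
  show Continuous fun v => pm (pmk v) a b
  simp only [pm_pmk]
  have h1 : ∀ a, Continuous fun v : {w : Fin (k + 1) → ℝ // w ≠ 0} => v.1 a := fun a =>
    (continuous_apply a).comp continuous_subtype_val
  refine ((h1 a).mul (h1 b)).div ?_ (fun v => dot_self_ne v)
  exact continuous_finsetSum _ fun i _ => (h1 i).mul (h1 i)

theorem pm_injective : Injective (pm (k := k)) := by
  intro p p' h
  obtain ⟨v, rfl⟩ := pmk_surj p
  obtain ⟨w, rfl⟩ := pmk_surj p'
  obtain ⟨a, ha⟩ := Function.ne_iff.1 v.2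
  have h0 := dot_self_ne v
  have h1 := dot_self_ne w
  have ha' : v.1 a ≠ 0 := ha
  have e : ∀ b, v.1 b = (w.1 a * (v.1 ⬝ᵥ v.1) / (v.1 a * (w.1 ⬝ᵥ w.1))) * w.1 b := by
    intro b
    have h2 := congrFun (congrFun h a) b
    rw [pm_pmk, pm_pmk] at h2
    field_simp at h2 ⊢
    linarith
  rw [pmk_eq_iff]
  refine ⟨w.1 a * (v.1 ⬝ᵥ v.1) / (v.1 a * (w.1 ⬝ᵥ w.1)), ?_, funext e⟩
  intro h3
  have := e a
  rw [h3, zero_mul] at this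
  exact ha' this

instance : T2Space (RPn k) := T2Space.of_injective_continuous pm_injective pm_continuous

instance : CompactSpace (RPn k) := by
  constructor
  have hs : IsCompact (Metric.sphere (0 : Fin (k + 1) → ℝ) 1) := isCompact_sphere _ _
  have hne : ∀ v ∈ Metric.sphere (0 : Fin (k + 1) → ℝ) 1, v ≠ 0 := by
    rintro v hv rfl; simp at hv
  let f : Metric.sphere (0 : Fin (k + 1) → ℝ) 1 → RPn k := fun v => pmk ⟨v.1, hne v.1 v.2⟩
  have hf : Continuous f := pmk_continuous.comp (by fun_prop)
  haveI := isCompact_iff_compactSpace.1 hs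
  have hr : Set.range f = Set.univ := by
    rw [Set.range_eq_univ]
    intro p
    obtain ⟨v, rfl⟩ := pmk_surj p
    have hn : ‖v.1‖ ≠ 0 := norm_ne_zero_iff.2 v.2
    refine ⟨⟨‖v.1‖⁻¹ • v.1, ?_⟩, ?_⟩
    · rw [mem_sphere_zero_iff_norm, norm_smul, norm_inv, norm_norm, inv_mul_cancel₀ hn]
    · simp only [f]
      rw [pmk_eq_iff]
      exact ⟨‖v.1‖⁻¹, inv_ne_zero hn, rfl⟩
  rw [← hr]
  exact isCompact_range hf

/-- squared cosine of the angle between two lines -/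
noncomputable def ang (p q : RPn k) : ℝ := ∑ a, ∑ b, pm p a b * pm q a b

theorem ang_pmk (v w : {w : Fin (k + 1) → ℝ // w ≠ 0}) :
    ang (pmk v) (pmk w) = (v.1 ⬝ᵥ w.1) ^ 2 / ((v.1 ⬝ᵥ v.1) * (w.1 ⬝ᵥ w.1)) := by
  unfold ang
  simp only [pm_pmk]
  rw [sq]
  conv_rhs => rw [dotProduct, Finset.sum_mul_sum, Finset.sum_div]
  refine Finset.sum_congr rfl fun a _ => ?_
  rw [Finset.sum_div]
  refine Finset.sum_congr rfl fun b _ => ?_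
  have h0 := dot_self_ne v
  have h1 := dot_self_ne w
  field_simp

theorem pm_cont_apply (a b : Fin (k + 1)) : Continuous fun p : RPn k => pm p a b :=
  (continuous_apply_apply a b).comp pm_continuous

theorem ang_continuous : Continuous fun pq : RPn k × RPn k => ang pq.1 pq.2 := by
  unfold ang
  refine continuous_finsetSum _ fun a _ => continuous_finsetSum _ fun b _ => ?_
  exact ((pm_cont_apply a b).comp continuous_fst).mul ((pm_cont_apply a b).comp continuous_snd)

theorem ang_self (p : RPn k) : ang p p = 1 := by
  obtain ⟨v, rfl⟩ := pmk_surj p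
  rw [ang_pmk, sq]
  have h0 := dot_self_ne v
  field_simp

/-- `M` carries the lines `p z` to the lines `q z`. -/
def Transp {K : Type*} [TopologicalSpace K] (p q : K → RPn k) : Prop :=
  ∃ M : K → Matrix (Fin (k + 1)) (Fin (k + 1)) ℝ, Continuous M ∧
    ∀ z (u : {w : Fin (k + 1) → ℝ // w ≠ 0}), pmk u = p z →
      ∃ u' : {w : Fin (k + 1) → ℝ // w ≠ 0}, u'.1 = Matrix.mulVec (M z) u.1 ∧ pmk u' = q z

theorem Transp.trans {K : Type*} [TopologicalSpace K] {p q r : K → RPn k}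
    (h1 : Transp p q) (h2 : Transp q r) : Transp p r := by
  obtain ⟨M, hM, h1⟩ := h1
  obtain ⟨N, hN, h2⟩ := h2
  refine ⟨fun z => N z * M z, hN.matrix_mul hM, fun z u hu => ?_⟩
  obtain ⟨u', e1, e2⟩ := h1 z u hu
  obtain ⟨u'', e3, e4⟩ := h2 z u' e2
  exact ⟨u'', by rw [e3, e1, Matrix.mulVec_mulVec], e4⟩

theorem Transp.of_ang {K : Type*} [TopologicalSpace K] {p q : K → RPn k} (hq : Continuous q)
    (h : ∀ z, 0 < ang (p z) (q z)) : Transp p q := by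
  refine ⟨fun z => pm (q z), pm_continuous.comp hq, fun z u hu => ?_⟩
  obtain ⟨v, hv⟩ := pmk_surj (q z)
  have h1 := h z
  rw [← hu, ← hv, ang_pmk] at h1
  have h2 : u.1 ⬝ᵥ v.1 ≠ 0 := by
    intro h2; rw [h2] at h1; simp at h1
  have e : Matrix.mulVec (pm (q z)) u.1 = ((u.1 ⬝ᵥ v.1) / (v.1 ⬝ᵥ v.1)) • v.1 := by
    rw [← hv]
    funext a
    simp only [Matrix.mulVec, dotProduct, pm_pmk, Pi.smul_apply, smul_eq_mul]
    rw [Finset.sum_div, Finset.sum_mul]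
    refine Finset.sum_congr rfl fun b _ => ?_
    ring
  have hc : (u.1 ⬝ᵥ v.1) / (v.1 ⬝ᵥ v.1) ≠ 0 := div_ne_zero h2 (dot_self_ne v)
  refine ⟨⟨Matrix.mulVec (pm (q z)) u.1, by rw [e]; exact smul_ne_zero hc v.2⟩, rfl, ?_⟩
  refine Eq.trans ?_ hv
  rw [pmk_eq_iff]
  exact ⟨_, hc, e⟩

theorem ang_comm (p q : RPn k) : ang p q = ang q p := by
  unfold ang
  simp only [mul_comm]

theorem Transp.of_path {K : Type*} [TopologicalSpace K] [CompactSpace K] (γ : K × I → RPn k)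
    (hγ : Continuous γ) (t t' : I) : Transp (fun z => γ (z, t)) (fun z => γ (z, t')) := by
  refine PreconnectedSpace.induction₂'
    (fun t t' : I => Transp (fun z => γ (z, t)) (fun z => γ (z, t'))) ?_ ?_ t t'
  · intro t
    have hc : Continuous fun w : I × K => ang (γ (w.2, t)) (γ (w.2, w.1)) := by
      have c1 : Continuous fun w : I × K => γ (w.2, t) :=
        hγ.comp (Continuous.prodMk continuous_snd continuous_const)
      have c2 : Continuous fun w : I × K => γ (w.2, w.1) :=
        hγ.comp (Continuous.prodMk continuous_snd continuous_fst)
      exact Continuous.comp (g := fun pq : RPn k × RPn k => ang pq.1 pq.2)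
        (f := fun w : I × K => (γ (w.2, t), γ (w.2, w.1))) ang_continuous (c1.prodMk c2)
    have c3 : ∀ t, Continuous fun z => γ (z, t) := fun t =>
      hγ.comp (Continuous.prodMk continuous_id continuous_const)
    have := isCompact_univ.eventually_forall_of_forall_eventually (x₀ := t) (K := (Set.univ : Set K))
      (P := fun t' z => 0 < ang (γ (z, t)) (γ (z, t'))) (by
        intro z _
        have h0 : 0 < ang (γ (z, t)) (γ (z, t)) := by rw [ang_self]; exact one_pos
        exact hc.continuousAt.eventually (lt_mem_nhds h0))
    filter_upwards [this] with t' ht'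
    constructor
    · exact Transp.of_ang (c3 _) fun z => ht' z trivial
    · exact Transp.of_ang (c3 _) fun z => by rw [ang_comm]; exact ht' z trivial
  · exact ⟨fun _ _ _ h1 h2 => h1.trans h2⟩
end

section
variable {r s : ℕ}

/-- the bilinear form defining the Milnor manifold -/
def mdot (r s : ℕ) (x : Fin (r + 1) → ℝ) (y : Fin (s + 1) → ℝ) : ℝ :=
  ∑ i : Fin (min (s + 1) (r + 1)),
      x (Fin.castLE (min_le_right _ _) i) * y (Fin.castLE (min_le_left _ _) i)

theorem mem_milnor_iff (x : {w : Fin (r + 1) → ℝ // w ≠ 0}) (y : {w : Fin (s + 1) → ℝ // w ≠ 0}) :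
    (pmk x, pmk y) ∈ RealMilnor r s ↔ mdot r s x.1 y.1 = 0 := by
  obtain ⟨c, hc⟩ := Projectivization.exists_smul_eq_mk_rep ℝ x.1 x.2
  obtain ⟨d, hd⟩ := Projectivization.exists_smul_eq_mk_rep ℝ y.1 y.2
  have hc' : (pmk x).rep = (c : ℝ) • x.1 := hc.symm
  have hd' : (pmk y).rep = (d : ℝ) • y.1 := hd.symm
  have hc0 : (c : ℝ) ≠ 0 := c.ne_zero
  have hd0 : (d : ℝ) ≠ 0 := d.ne_zero
  have e : (pmk x, pmk y) ∈ RealMilnor r s ↔ mdot r s (pmk x).rep (pmk y).rep = 0 := Iff.rfl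
  rw [e, hc', hd']
  have : mdot r s ((c : ℝ) • x.1) ((d : ℝ) • y.1) = (c * d : ℝ) * mdot r s x.1 y.1 := by
    unfold mdot
    rw [Finset.mul_sum]
    refine Finset.sum_congr rfl fun i _ => ?_
    simp only [Pi.smul_apply, smul_eq_mul]; ring
  rw [this]
  simp [hc0, hd0]

theorem milnor_isClosed : IsClosed (RealMilnor r s) := by
  let g : RPn r × RPn s → ℝ := fun p => ∑ i : Fin (min (s + 1) (r + 1)), ∑ j : Fin (min (s + 1) (r + 1)),
    pm p.1 (Fin.castLE (min_le_right _ _) i) (Fin.castLE (min_le_right _ _) j) *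
    pm p.2 (Fin.castLE (min_le_left _ _) i) (Fin.castLE (min_le_left _ _) j)
  have hg : Continuous g := by
    refine continuous_finsetSum _ fun a _ => continuous_finsetSum _ fun b _ => ?_
    exact ((pm_cont_apply _ _).comp continuous_fst).mul ((pm_cont_apply _ _).comp continuous_snd)
  have he : RealMilnor r s = g ⁻¹' {0} := by
    ext ⟨p, q⟩
    obtain ⟨x, rfl⟩ := pmk_surj p
    obtain ⟨y, rfl⟩ := pmk_surj q
    rw [mem_milnor_iff, Set.mem_preimage, Set.mem_singleton_iff]
    have : g (pmk x, pmk y) = (mdot r s x.1 y.1) ^ 2 / ((x.1 ⬝ᵥ x.1) * (y.1 ⬝ᵥ y.1)) := by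
      simp only [g, pm_pmk]
      rw [sq]
      conv_rhs => rw [mdot, Finset.sum_mul_sum, Finset.sum_div]
      refine Finset.sum_congr rfl fun a _ => ?_
      rw [Finset.sum_div]
      refine Finset.sum_congr rfl fun b _ => ?_
      have h0 := dot_self_ne x
      have h1 := dot_self_ne y
      field_simp
    rw [this]
    have h0 := dot_self_ne x
    have h1 := dot_self_ne y
    simp [h0, h1]
  rw [he]
  exact isClosed_singleton.preimage hg

instance : CompactSpace (RealMilnor r s) :=
  isCompact_iff_compactSpace.1 milnor_isClosed.isCompact
end

open Function
open scoped unitInterval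

section
variable {ι : Type*} [Fintype ι] [DecidableEq ι] (q : ι → ℕ)

/-- bilinear functions -/
noncomputable def bil (α β : ι) (N : Fin (q α + 1) → Fin (q β + 1) → C(PSp q, ℝ)) : C(PSp q, ℝ) where
  toFun v := ∑ a, ∑ b, (v α).1 a * N a b v * (v β).1 b
  continuous_toFun := by
    refine continuous_finsetSum _ fun a _ => continuous_finsetSum _ fun b _ => ?_
    refine Continuous.mul (Continuous.mul ?_ (N a b).continuous) ?_
    · exact (continuous_apply a).comp (continuous_subtype_val.comp (continuous_apply α))
    · exact (continuous_apply b).comp (continuous_subtype_val.comp (continuous_apply β))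

theorem bil_eqv (α β : ι) (hαβ : α ≠ β) (N : Fin (q α + 1) → Fin (q β + 1) → C(PSp q, ℝ))
    (hN : ∀ a b i v, N a b (flipAt q i v) = N a b v) : EqvChar q (bil q α β N) (pch α β) := by
  intro i v
  show ∑ a, ∑ b, (flipAt q i v α).1 a * N a b (flipAt q i v) * (flipAt q i v β).1 b =
    _ * ∑ a, ∑ b, (v α).1 a * N a b v * (v β).1 b
  simp only [hN, Finset.mul_sum]
  refine Finset.sum_congr rfl fun a _ => Finset.sum_congr rfl fun b _ => ?_
  by_cases h1 : i = α
  · subst h1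
    simp [flipAt, pch, hαβ, Ne.symm hαβ]
  · by_cases h2 : i = β
    · subst h2
      simp [flipAt, pch, hαβ, Ne.symm hαβ]
    · simp [flipAt, pch, h1, h2, Ne.symm h1, Ne.symm h2]
end

/-- Parallel transport along the motion planner. -/
theorem transp_of_planner {X : Type*} [TopologicalSpace X] {k n : ℕ} (pr : X → RPn k)
    (hpr : Continuous pr) (U : Set (Fin (n + 2) → X)) (sec : C(U, C(I, X)))
    (H : C(U × I, Fin (n + 2) → X)) (h0 : ∀ v : U, H (v, 0) = tcPi X (n + 2) (sec v))
    (h1 : ∀ v : U, H (v, 1) = (v : Fin (n + 2) → X))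
    (K : Set (Fin (n + 2) → X)) (hK : IsCompact K) (hKU : K ⊆ U) (i j : Fin (n + 2)) :
    Transp (fun z : K => pr (z.1 i)) (fun z : K => pr (z.1 j)) := by
  have := isCompact_iff_compactSpace.1 hK
  let inc : K → U := fun z => ⟨z.1, hKU z.2⟩
  have hinc : Continuous inc := by fun_prop
  let γ : Fin (n + 2) → K × I → RPn k := fun i w => pr (H (inc w.1, w.2) i)
  have hγ : ∀ i, Continuous (γ i) := by
    intro i
    refine hpr.comp ((continuous_apply i).comp (H.continuous.comp ?_))
    exact (hinc.comp continuous_fst).prodMk continuous_snd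
  let δ : K × I → RPn k := fun w => pr (sec (inc w.1) w.2)
  have hδ : Continuous δ := by
    refine hpr.comp ?_
    have h2 : Continuous fun w : K × I => sec (inc w.1) := sec.continuous.comp (hinc.comp continuous_fst)
    exact h2.eval continuous_snd
  have e1 : ∀ i, (fun z : K => γ i (z, 1)) = fun z : K => pr (z.1 i) := by
    intro i; funext z
    simp only [γ, h1, inc]
  let T : Fin (n + 2) → I := fun i =>
    Set.projIcc (0 : ℝ) 1 zero_le_one ((i : ℝ) / (((n + 2 : ℕ) : ℝ) - 1))
  have e0 : ∀ i, (fun z : K => γ i (z, 0)) = fun z : K => δ (z, T i) := by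
    intro i; funext z
    simp only [γ, h0, δ]
    rfl
  have a1 := Transp.of_path (γ i) (hγ i) 1 0
  have a2 := Transp.of_path δ hδ (T i) (T j)
  have a3 := Transp.of_path (γ j) (hγ j) 0 1
  rw [e1, e0] at a1
  rw [e1, e0] at a3
  exact (a1.trans a2).trans a3

theorem transp_extend {K Y : Type*} [TopologicalSpace K] [TopologicalSpace Y] [CompactSpace K]
    [CompactSpace Y] [T2Space Y] {k : ℕ} (e : K → Y) (he : Continuous e) (hinj : Injective e)
    {p q : K → RPn k} (h : Transp p q) :
    ∃ N : Fin (k + 1) → Fin (k + 1) → C(Y, ℝ), ∀ z (u w : {w : Fin (k + 1) → ℝ // w ≠ 0}),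
      pmk u = p z → pmk w = q z → ∑ a, ∑ b, w.1 a * N a b (e z) * u.1 b ≠ 0 := by
  obtain ⟨M, hM, h⟩ := h
  have hce : Topology.IsClosedEmbedding e := he.isClosedEmbedding hinj
  have hex : ∀ a b, ∃ g : C(Y, ℝ), ∀ z, g (e z) = M z a b := by
    intro a b
    obtain ⟨g, hg⟩ := ContinuousMap.exists_extension hce
      (⟨fun z => M z a b, (continuous_apply_apply a b).comp hM⟩ : C(K, ℝ))
    exact ⟨g, fun z => congrArg (fun f : C(K, ℝ) => f z) hg⟩
  choose N hN using hex
  refine ⟨N, fun z u w hu hw => ?_⟩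
  obtain ⟨u', e1, e2⟩ := h z u hu
  have e3 : ∑ a, ∑ b, w.1 a * N a b (e z) * u.1 b = w.1 ⬝ᵥ u'.1 := by
    rw [e1]
    simp only [dotProduct, Matrix.mulVec, hN, Finset.mul_sum, mul_assoc]
  rw [e3]
  obtain ⟨c, hc, e4⟩ := (pmk_eq_iff u' w).1 (e2.trans hw.symm)
  rw [e4, dotProduct_smul, smul_eq_mul]
  exact mul_ne_zero hc (dot_self_ne w)

section
variable (r s n : ℕ)

/-- dimensions -/
abbrev qq : Fin (n + 2) ⊕ Fin (n + 2) → ℕ := Sum.elim (fun _ => r) (fun _ => s)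

/-- the projection to the product of projective spaces. -/
noncomputable def Qm (v : PSp (qq r s n)) : Fin (n + 2) → RPn r × RPn s :=
  fun j => (pmk (k := r) (v (Sum.inl j)), pmk (k := s) (v (Sum.inr j)))

theorem Qm_continuous : Continuous (Qm r s n) := by
  refine continuous_pi fun j => Continuous.prodMk ?_ ?_
  · exact (pmk_continuous (k := r)).comp (continuous_apply (Sum.inl j))
  · exact (pmk_continuous (k := s)).comp (continuous_apply (Sum.inr j))

theorem pmk_neg {k : ℕ} (v : {w : Fin (k + 1) → ℝ // w ≠ 0}) :
    pmk (⟨-v.1, neg_ne_zero.2 v.2⟩ : {w : Fin (k + 1) → ℝ // w ≠ 0}) = pmk v := by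
  rw [pmk_eq_iff]
  exact ⟨-1, by norm_num, by simp⟩

theorem Qm_flip (i : Fin (n + 2) ⊕ Fin (n + 2)) (v : PSp (qq r s n)) :
    Qm r s n (flipAt _ i v) = Qm r s n v := by
  have key : ∀ j, pmk (k := qq r s n j) (flipAt _ i v j) = pmk (k := qq r s n j) (v j) := by
    intro j
    by_cases hj : j = i
    · subst hj
      simp only [flipAt, update_self]
      exact pmk_neg _
    · simp only [flipAt, update_of_ne hj]
  funext j
  exact Prod.ext (key (Sum.inl j)) (key (Sum.inr j))

theorem planner_function (U : Set (Fin (n + 2) → RealMilnor r s))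
    (sec : C(U, C(I, RealMilnor r s)))
    (H : C(U × I, Fin (n + 2) → RealMilnor r s)) (h0 : ∀ v : U, H (v, 0) = tcPi _ (n + 2) (sec v))
    (h1 : ∀ v : U, H (v, 1) = (v : Fin (n + 2) → RealMilnor r s))
    (K : Set (Fin (n + 2) → RealMilnor r s)) (hK : IsCompact K) (hKU : K ⊆ U)
    (τ : Fin (n + 2) ⊕ Fin (n + 2)) (hτ0 : τ ≠ Sum.inl 0) (hτ1 : τ ≠ Sum.inr 0) :
    ∃ f : C(PSp (qq r s n), ℝ), EqvChar _ f (tch τ) ∧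
      ∀ v, ∀ z ∈ K, Qm r s n v = (fun j => (z j).1) → f v ≠ 0 := by
  have := isCompact_iff_compactSpace.1 hK
  let e : K → (Fin (n + 2) → RPn r × RPn s) := fun z j => (z.1 j).1
  have he : Continuous e := continuous_pi fun j =>
    continuous_subtype_val.comp ((continuous_apply j).comp continuous_subtype_val)
  have hinj : Injective e := by
    intro z w h
    apply Subtype.ext
    funext j
    apply Subtype.ext
    exact congrFun h j
  let QM : C(PSp (qq r s n), Fin (n + 2) → RPn r × RPn s) := ⟨Qm r s n, Qm_continuous r s n⟩
  rcases τ with j | j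
  · have hj : (Sum.inl j : Fin (n + 2) ⊕ Fin (n + 2)) ≠ Sum.inl 0 := hτ0
    obtain ⟨N, hN⟩ := transp_extend e he hinj (transp_of_planner (fun x : RealMilnor r s => x.1.1)
      (continuous_fst.comp continuous_subtype_val) U sec H h0 h1 K hK hKU 0 j)
    refine ⟨bil (qq r s n) (Sum.inl j) (Sum.inl 0) (fun a b => (N a b).comp QM), ?_, ?_⟩
    · have := bil_eqv (qq r s n) (Sum.inl j) (Sum.inl 0) hj (fun a b => (N a b).comp QM) (by
        intro a b i v
        show N a b (Qm r s n _) = N a b (Qm r s n v)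
        rw [Qm_flip])
      have e : (tch (Sum.inl j) : Fin (n + 2) ⊕ Fin (n + 2) → ZMod 2) = pch (Sum.inl j) (Sum.inl 0) := by
        simp only [tch, pch, add_comm]
      rw [e]; exact this
    · intro v z hz hv
      have h2 := hN ⟨z, hz⟩ (v (Sum.inl 0)) (v (Sum.inl j)) (congrArg Prod.fst (congrFun hv 0))
        (congrArg Prod.fst (congrFun hv j))
      have h3 : e ⟨z, hz⟩ = Qm r s n v := hv.symm
      rw [h3] at h2
      exact h2
  · have hj : (Sum.inr j : Fin (n + 2) ⊕ Fin (n + 2)) ≠ Sum.inr 0 := hτ1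
    obtain ⟨N, hN⟩ := transp_extend e he hinj (transp_of_planner (fun x : RealMilnor r s => x.1.2)
      (continuous_snd.comp continuous_subtype_val) U sec H h0 h1 K hK hKU 0 j)
    refine ⟨bil (qq r s n) (Sum.inr j) (Sum.inr 0) (fun a b => (N a b).comp QM), ?_, ?_⟩
    · have := bil_eqv (qq r s n) (Sum.inr j) (Sum.inr 0) hj (fun a b => (N a b).comp QM) (by
        intro a b i v
        show N a b (Qm r s n _) = N a b (Qm r s n v)
        rw [Qm_flip])
      have e : (tch (Sum.inr j) : Fin (n + 2) ⊕ Fin (n + 2) → ZMod 2) = pch (Sum.inr j) (Sum.inr 0) := by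
        simp only [tch, pch, add_comm]
      rw [e]; exact this
    · intro v z hz hv
      have h2 := hN ⟨z, hz⟩ (v (Sum.inr 0)) (v (Sum.inr j)) (congrArg Prod.snd (congrFun hv 0))
        (congrArg Prod.snd (congrFun hv j))
      have h3 : e ⟨z, hz⟩ = Qm r s n v := hv.symm
      rw [h3] at h2
      exact h2

/-- constraint functions -/
noncomputable def constrF (j : Fin (n + 2)) : C(PSp (qq r s n), ℝ) :=
  bil (qq r s n) (Sum.inr j) (Sum.inl j)
    (fun (a : Fin (s + 1)) (b : Fin (r + 1)) => ContinuousMap.const _ (if (a : ℕ) = b then 1 else 0))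

theorem constrF_eqv (j : Fin (n + 2)) :
    EqvChar _ (constrF r s n j) (pch (Sum.inr j) (Sum.inl j)) :=
  bil_eqv _ _ _ (by simp) _ (fun _ _ _ _ => rfl)

theorem constrF_eq (j : Fin (n + 2)) (v : PSp (qq r s n)) (hsr : s ≤ r) :
    constrF r s n j v = mdot r s (v (Sum.inl j)).1 (v (Sum.inr j)).1 := by
  show ∑ a : Fin (s + 1), ∑ b : Fin (r + 1), (v (Sum.inr j)).1 a *
    (if (a : ℕ) = b then 1 else 0) * (v (Sum.inl j)).1 b = _
  unfold mdot
  have hmin : s + 1 = min (s + 1) (r + 1) := by omega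
  rw [← (finCongr hmin).sum_comp]
  refine Finset.sum_congr rfl fun a _ => ?_
  rw [Finset.sum_eq_single (Fin.castLE (by omega) a : Fin (r + 1))]
  · simp only [Fin.val_castLE, if_true, mul_one]
    rw [mul_comm]
    rfl
  · intro b _ hb
    rw [if_neg]
    · simp
    · intro h; exact hb (Fin.ext h.symm)
  · simp

theorem lower_bound (t : ℕ) (hsr : s ≤ r) (hrt : 2 ^ t + 1 ≤ r) (k : ℕ)
    (U : Fin k → Set (Fin (n + 2) → RealMilnor r s)) (hU : ∀ i, IsOpen (U i))
    (hcov : (⋃ i, U i) = Set.univ)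
    (hsec : ∀ i, ∃ sec : C(U i, C(I, RealMilnor r s)),
      ∃ H : C(U i × I, Fin (n + 2) → RealMilnor r s),
        (∀ v : U i, H (v, 0) = tcPi _ (n + 2) (sec v)) ∧
        (∀ v : U i, H (v, 1) = (v : Fin (n + 2) → RealMilnor r s))) :
    (listT1 n s).length + (listT2 n t).length < k := by
  classical
  by_contra! hk
  obtain ⟨K, hKcov, hKc, hKU⟩ := exists_iUnion_eq_closed_subset (u := U) hU
    (fun x => Set.toFinite _) hcov
  have key : ∀ (i : ℕ) (τ : Fin (n + 2) ⊕ Fin (n + 2)), ∃ f : C(PSp (qq r s n), ℝ),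
      τ ≠ Sum.inl 0 → τ ≠ Sum.inr 0 → EqvChar _ f (tch τ) ∧
      ∀ (hi : i < k), ∀ v, ∀ z ∈ K ⟨i, hi⟩, Qm r s n v = (fun j => (z j).1) → f v ≠ 0 := by
    intro i τ
    by_cases h0 : τ ≠ Sum.inl 0
    · by_cases h1 : τ ≠ Sum.inr 0
      · by_cases hi : i < k
        · obtain ⟨sec, H, a, b⟩ := hsec ⟨i, hi⟩
          obtain ⟨f, hf1, hf2⟩ := planner_function r s n (U ⟨i, hi⟩) sec H a b (K ⟨i, hi⟩)
            (hKc _).isCompact (hKU _) τ h0 h1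
          exact ⟨f, fun _ _ => ⟨hf1, fun _ => hf2⟩⟩
        · refine ⟨0, fun _ _ => ⟨fun i v => ?_, fun h => absurd h hi⟩⟩
          simp
      · exact ⟨0, fun _ h => absurd h h1⟩
    · exact ⟨0, fun h => absurd h h0⟩
  choose F hF using key
  have hT1 : ∀ τ ∈ listT1 n s, τ ≠ Sum.inl 0 ∧ τ ≠ Sum.inr 0 := by
    intro τ hτ
    simp only [listT1, List.mem_flatMap, List.mem_replicate] at hτ
    obtain ⟨j, _, _, rfl⟩ := hτ
    simp
  have hT2 : ∀ τ ∈ listT2 n t, τ ≠ Sum.inl 0 ∧ τ ≠ Sum.inr 0 := by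
    intro τ hτ
    simp only [listT2, List.mem_append, List.mem_flatMap, List.mem_replicate] at hτ
    rcases hτ with ⟨_, rfl⟩ | ⟨j, _, _, rfl⟩
    · simp
    · simp
  let L1 : List (C(PSp (qq r s n), ℝ) × (Fin (n + 2) ⊕ Fin (n + 2) → ZMod 2)) :=
    (listT1 n s).zipIdx.map fun p => (F p.2 p.1, tch p.1)
  let LC : List (C(PSp (qq r s n), ℝ) × (Fin (n + 2) ⊕ Fin (n + 2) → ZMod 2)) :=
    (List.finRange (n + 2)).map fun j => (constrF r s n j, pch (Sum.inr j) (Sum.inl j))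
  let L2 : List (C(PSp (qq r s n), ℝ) × (Fin (n + 2) ⊕ Fin (n + 2) → ZMod 2)) :=
    ((listT2 n t).zipIdx (listT1 n s).length).map fun p => (F p.2 p.1, tch p.1)
  have zm : ∀ (T : List (Fin (n + 2) ⊕ Fin (n + 2))) (m : ℕ),
      ((T.zipIdx m).map fun p => (F p.2 p.1, tch p.1)).map Prod.snd = T.map tch := by
    intro T m
    rw [List.map_map]
    conv_rhs => rw [← List.zipIdx_map_fst m T]
    rw [List.map_map]
    rfl
  have hb := borsukUlam (qq r s n) (L1 ++ LC ++ L2) (by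
      intro p hp
      simp only [List.mem_append] at hp
      rcases hp with (hp | hp) | hp
      · obtain ⟨⟨τ, i⟩, hm, rfl⟩ := List.mem_map.1 hp
        have hτ := hT1 τ (List.fst_mem_of_mem_zipIdx hm)
        exact (hF i τ hτ.1 hτ.2).1
      · obtain ⟨j, _, rfl⟩ := List.mem_map.1 hp
        exact constrF_eqv r s n j
      · obtain ⟨⟨τ, i⟩, hm, rfl⟩ := List.mem_map.1 hp
        have hτ := hT2 τ (List.fst_mem_of_mem_zipIdx hm)
        exact (hF i τ hτ.1 hτ.2).1) (by
      intro v
      by_cases hc : ∀ j, constrF r s n j v = 0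
      · have hmem : ∀ j, Qm r s n v j ∈ RealMilnor r s := by
          intro j
          have := hc j
          rw [constrF_eq r s n j v hsr] at this
          exact (mem_milnor_iff (r := r) (s := s) (v (Sum.inl j)) (v (Sum.inr j))).2 this
        let z : Fin (n + 2) → RealMilnor r s := fun j => ⟨Qm r s n v j, hmem j⟩
        have hz : z ∈ ⋃ i, K i := by rw [hKcov]; trivial
        obtain ⟨⟨i, hi⟩, hzi⟩ := Set.mem_iUnion.1 hz
        by_cases hi1 : i < (listT1 n s).length
        · refine ⟨(F i (listT1 n s)[i], tch (listT1 n s)[i]), ?_, ?_⟩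
          · refine List.mem_append_left _ (List.mem_append_left _ (List.mem_map.2
              ⟨((listT1 n s)[i], i), ?_, rfl⟩))
            rw [List.mk_mem_zipIdx_iff_getElem?]
            exact List.getElem?_eq_getElem hi1
          · have hτ := hT1 _ (List.getElem_mem hi1)
            exact (hF i _ hτ.1 hτ.2).2 hi v z hzi rfl
        · have hi2 : i - (listT1 n s).length < (listT2 n t).length := by omega
          refine ⟨(F i (listT2 n t)[i - (listT1 n s).length],
            tch (listT2 n t)[i - (listT1 n s).length]), ?_, ?_⟩
          · refine List.mem_append_right _ (List.mem_map.2
              ⟨((listT2 n t)[i - (listT1 n s).length], i), ?_, rfl⟩)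
            rw [List.mk_mem_zipIdx_iff_le_and_getElem?_sub]
            exact ⟨by omega, List.getElem?_eq_getElem hi2⟩
          · have hτ := hT2 _ (List.getElem_mem hi2)
            exact (hF i _ hτ.1 hτ.2).2 hi v z hzi rfl
      · push Not at hc
        obtain ⟨j, hj⟩ := hc
        exact ⟨(constrF r s n j, pch (Sum.inr j) (Sum.inl j)),
          List.mem_append_left _ (List.mem_append_right _ (List.mem_map.2
            ⟨j, List.mem_finRange j, rfl⟩)), hj⟩)
    (degD n s t) (by
      rintro (j | j)
      · refine Fin.cases ?_ (fun j => ?_) j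
        · simpa [degD] using hrt
        · simp [degD]; omega
      · refine Fin.cases ?_ (fun j => ?_) j
        · simp [degD]
        · simp [degD])
  rw [List.map_append, List.map_append] at hb
  have hLC : LC.map Prod.snd = listC n := by
    simp only [LC, listC, List.map_map]
    rfl
  rw [show L1.map Prod.snd = (listT1 n s).map tch from zm _ _,
    show L2.map Prod.snd = (listT2 n t).map tch from zm _ _, hLC, bnum_main] at hb
  exact one_ne_zero hb
end

open Function
open scoped unitInterval

section kuhn
variable {κ : Type*} [Fintype κ]

/-- open star of a vertex of the Kuhn triangulation. -/
def kst (z : κ → ℤ) : Set (κ → ℝ) :=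
  {x | (∀ a, |x a - z a| < 1) ∧ ∀ a b, (x a - z a) - (x b - z b) < 1}

theorem kst_open (z : κ → ℤ) : IsOpen (kst z) := by
  have e : kst z = (⋂ a, {x : κ → ℝ | |x a - z a| < 1}) ∩
      ⋂ a, ⋂ b, {x : κ → ℝ | (x a - z a) - (x b - z b) < 1} := by
    ext x
    simp only [Set.mem_inter_iff, Set.mem_iInter]
    exact Iff.rfl
  rw [e]
  refine (isOpen_iInter_of_finite fun a => ?_).inter
    (isOpen_iInter_of_finite fun a => isOpen_iInter_of_finite fun b => ?_)
  · exact isOpen_lt (by fun_prop) continuous_const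
  · exact isOpen_lt (by fun_prop) continuous_const

theorem kst_floor (x : κ → ℝ) : x ∈ kst (fun a => ⌊x a⌋) := by
  have h1 : ∀ a, (⌊x a⌋ : ℝ) ≤ x a := fun a => Int.floor_le _
  have h2 : ∀ a, x a < ⌊x a⌋ + 1 := fun a => Int.lt_floor_add_one _
  refine ⟨fun a => ?_, fun a b => ?_⟩
  · rw [abs_lt]; constructor <;> linarith [h1 a, h2 a]
  · linarith [h1 b, h2 a]

theorem kst_chain {x : κ → ℝ} {z z' : κ → ℤ} (h : x ∈ kst z) (h' : x ∈ kst z') :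
    z ≤ z' ∨ z' ≤ z := by
  by_contra! hc
  obtain ⟨h1, h2⟩ := hc
  rw [Pi.le_def] at h1 h2
  push Not at h1 h2
  obtain ⟨b, hb⟩ := h1
  obtain ⟨a, ha⟩ := h2
  have e1 := h.2 a b
  have e2 := h'.2 b a
  have hb' : (z' b : ℝ) + 1 ≤ z b := by exact_mod_cast hb
  have ha' : (z a : ℝ) + 1 ≤ z' a := by exact_mod_cast ha
  linarith

theorem kst_card (x : κ → ℝ) (S : Finset (κ → ℤ)) (h : ∀ z ∈ S, x ∈ kst z) :
    S.card ≤ Fintype.card κ + 1 := by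
  have hz : ∀ z ∈ S, ∀ a, 0 ≤ z a - ⌊x a⌋ ∧ z a - ⌊x a⌋ ≤ 1 := by
    intro z hz a
    have h1 := abs_lt.1 ((h z hz).1 a)
    have h2 : (⌊x a⌋ : ℝ) ≤ x a := Int.floor_le _
    have h3 : x a < ⌊x a⌋ + 1 := Int.lt_floor_add_one _
    constructor
    · have : (⌊x a⌋ : ℝ) < z a + 1 := by linarith
      have : ⌊x a⌋ < z a + 1 := by exact_mod_cast this
      omega
    · have : (z a : ℝ) < ⌊x a⌋ + 2 := by linarith
      have : z a < ⌊x a⌋ + 2 := by exact_mod_cast this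
      omega
  have hs0 : ∀ z ∈ S, 0 ≤ ∑ a, (z a - ⌊x a⌋) := fun z hS => Finset.sum_nonneg fun a _ => (hz z hS a).1
  have hs1 : ∀ z ∈ S, ∑ a, (z a - ⌊x a⌋) ≤ Fintype.card κ := by
    intro z hS
    calc ∑ a, (z a - ⌊x a⌋) ≤ ∑ _a : κ, (1 : ℤ) := Finset.sum_le_sum fun a _ => (hz z hS a).2
      _ = Fintype.card κ := by simp
  rw [← Finset.card_range (Fintype.card κ + 1)]
  refine Finset.card_le_card_of_injOn (fun z => (∑ a, (z a - ⌊x a⌋)).toNat) ?_ ?_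
  · intro z hS
    have := hs1 z hS
    simp only [Finset.coe_range, Set.mem_Iio]
    omega
  · intro z hS z' hS' he
    have he' : ∑ a, (z a - ⌊x a⌋) = ∑ a, (z' a - ⌊x a⌋) := by
      have := hs0 z hS
      have := hs0 z' hS'
      simp only at he
      omega
    have key : ∀ w w' : κ → ℤ, w ≤ w' → ∑ a, (w a - ⌊x a⌋) = ∑ a, (w' a - ⌊x a⌋) → w = w' := by
      intro w w' hw hs
      have := (Finset.sum_eq_sum_iff_of_le (fun a _ => sub_le_sub_right (hw a) _)).1 hs
      funext a
      have := this a (Finset.mem_univ a)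
      linarith
    rcases kst_chain (h z hS) (h z' hS') with hle | hle
    · exact key _ _ hle he'
    · exact (key _ _ hle he'.symm).symm

/-- order of a family at a point -/
def OrdLE {M J : Type*} (U : J → Set M) (x : M) (m : ℕ) : Prop :=
  ∀ S : Finset J, (∀ i ∈ S, x ∈ U i) → S.card ≤ m

theorem kuhn_refine {J : Type*} (B : Set (κ → ℝ)) (hB : IsCompact B) (O : J → Set (κ → ℝ))
    (hO : ∀ i, IsOpen (O i)) (hcov : B ⊆ ⋃ i, O i) :
    ∃ T : J → Set (κ → ℝ), (∀ i, IsOpen (T i)) ∧ (∀ i, T i ⊆ O i) ∧ B ⊆ ⋃ i, T i ∧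
      ∀ x, OrdLE T x (Fintype.card κ + 1) := by
  classical
  obtain ⟨δ, hδ, hleb⟩ := lebesgue_number_lemma_of_metric hB hO hcov
  let Tz : (κ → ℤ) → Set (κ → ℝ) := fun z => {x | (fun a => x a / (δ / 2)) ∈ kst z}
  have hTo : ∀ z, IsOpen (Tz z) := fun z => (kst_open z).preimage (by fun_prop)
  have hsub : ∀ z, (Tz z ∩ B).Nonempty → ∃ i, Tz z ⊆ O i := by
    rintro z ⟨y, hy, hyB⟩
    obtain ⟨i, hi⟩ := hleb y hyB
    refine ⟨i, fun x hx => hi ?_⟩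
    rw [Metric.mem_ball, dist_pi_lt_iff hδ]
    intro a
    have h1 := abs_lt.1 (hx.1 a)
    have h2 := abs_lt.1 (hy.1 a)
    have e1 : x a = x a / (δ / 2) * (δ / 2) := by field_simp
    have e2 : y a = y a / (δ / 2) * (δ / 2) := by field_simp
    rw [Real.dist_eq, abs_lt, e1, e2]
    have h3 : x a / (δ / 2) - y a / (δ / 2) < 2 := by linarith
    have h4 : -2 < x a / (δ / 2) - y a / (δ / 2) := by linarith
    constructor <;> nlinarith
  choose f hf using hsub
  let T : J → Set (κ → ℝ) := fun i => ⋃ z, ⋃ h : (Tz z ∩ B).Nonempty, ⋃ _ : f z h = i, Tz z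
  have memT : ∀ i x, x ∈ T i ↔ ∃ z, ∃ h : (Tz z ∩ B).Nonempty, f z h = i ∧ x ∈ Tz z := by
    intro i x
    simp only [T, Set.mem_iUnion, exists_prop]
  refine ⟨T, ?_, ?_, ?_, ?_⟩
  · intro i
    exact isOpen_iUnion fun z => isOpen_iUnion fun _ => isOpen_iUnion fun _ => hTo z
  · intro i x hx
    obtain ⟨z, h, rfl, hx2⟩ := (memT i x).1 hx
    exact hf z h hx2
  · intro x hx
    have h1 : x ∈ Tz (fun a => ⌊x a / (δ / 2)⌋) := kst_floor _
    exact Set.mem_iUnion.2 ⟨f _ ⟨x, h1, hx⟩, (memT _ _).2 ⟨_, ⟨x, h1, hx⟩, rfl, h1⟩⟩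
  · intro x S hS
    have h1 : ∀ i : S, ∃ z, ∃ h : (Tz z ∩ B).Nonempty, f z h = i.1 ∧ x ∈ Tz z := fun i =>
      (memT _ _).1 (hS i.1 i.2)
    choose g hg1 hg2 hg3 using h1
    have hinj : Injective g := by
      intro i j hij
      apply Subtype.ext
      rw [← hg2 i, ← hg2 j]
      congr 1
    have h2 := kst_card (fun a => x a / (δ / 2)) (Finset.univ.image g) (by
      intro z hz
      obtain ⟨i, _, rfl⟩ := Finset.mem_image.1 hz
      exact hg3 i)
    rw [Finset.card_image_of_injective _ hinj] at h2
    simpa using h2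
end kuhn

section act
variable {M G κ : Type*} [TopologicalSpace M] [CompactSpace M] [T2Space M] [Group G] [Finite G]
  [MulAction G M] [ContinuousConstSMul G M] [Fintype κ]

/-- saturation of a set -/
def satu (G : Type*) {M : Type*} [Group G] [MulAction G M] (A : Set M) : Set M :=
  {x | ∃ g : G, g • x ∈ A}

theorem satu_open {A : Set M} (h : IsOpen A) : IsOpen (satu G A) := by
  have : satu G A = ⋃ g : G, (fun x => g • x) ⁻¹' A := by
    ext x; simp only [Set.mem_iUnion]; exact Iff.rfl
  rw [this]
  exact isOpen_iUnion fun g => h.preimage (continuous_const_smul g)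

theorem satu_closed {A : Set M} (h : IsClosed A) : IsClosed (satu G A) := by
  have : satu G A = ⋃ g : G, (fun x => g • x) ⁻¹' A := by
    ext x; simp only [Set.mem_iUnion]; exact Iff.rfl
  rw [this]
  exact isClosed_iUnion_of_finite fun g => h.preimage (continuous_const_smul g)

theorem satu_inv {A : Set M} (g : G) {x : M} : g • x ∈ satu G A ↔ x ∈ satu G A := by
  constructor
  · rintro ⟨h, hh⟩
    exact ⟨h * g, by rw [mul_smul]; exact hh⟩
  · rintro ⟨h, hh⟩
    exact ⟨h * g⁻¹, by rw [mul_smul, inv_smul_smul]; exact hh⟩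

theorem sub_satu {A : Set M} {x : M} (h : x ∈ A) : x ∈ satu G A := ⟨1, by rwa [one_smul]⟩

theorem step_refine {J : Type*} (U : J → Set M) (hU : ∀ i, IsOpen (U i))
    (hinv : ∀ i (g : G) x, x ∈ U i → g • x ∈ U i) (hcov : ⋃ i, U i = Set.univ)
    (e : (κ → ℝ) → M) (he : Topology.IsOpenEmbedding e) (W A : Set M) (hW : IsOpen W)
    (hWe : W ⊆ Set.range e) (hWg : ∀ (g : G) x, x ∈ W → g • x ∈ W → g = 1)
    (hA : IsClosed A) (hAW : A ⊆ W) :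
    ∃ U' : J → Set M, (∀ i, IsOpen (U' i)) ∧ (∀ i (g : G) x, x ∈ U' i → g • x ∈ U' i) ∧
      (⋃ i, U' i = Set.univ) ∧ (∀ i, U' i ⊆ U i) ∧
      ∀ x ∈ A, OrdLE U' x (Fintype.card κ + 1) := by
  have hB : IsCompact (e ⁻¹' A) := by
    have := he.isInducing.isCompact_preimage' (K := A) hA.isCompact (hAW.trans hWe)
    exact this
  obtain ⟨T, hTo, hTO, hTB, hTord⟩ := kuhn_refine (e ⁻¹' A) hB (fun i => e ⁻¹' (U i ∩ W))
    (fun i => ((hU i).inter hW).preimage he.continuous) (by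
      intro y hy
      have : e y ∈ ⋃ i, U i := by rw [hcov]; trivial
      obtain ⟨i, hi⟩ := Set.mem_iUnion.1 this
      exact Set.mem_iUnion.2 ⟨i, hi, hAW hy⟩)
  have hVW : ∀ i, e '' T i ⊆ U i ∩ W := by
    rintro i _ ⟨y, hy, rfl⟩
    exact hTO i hy
  refine ⟨fun i => (U i \ satu G A) ∪ satu G (e '' T i), ?_, ?_, ?_, ?_, ?_⟩
  · intro i
    exact ((hU i).sdiff (satu_closed hA)).union (satu_open (he.isOpenMap _ (hTo i)))
  · rintro i g x (⟨h1, h2⟩ | h)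
    · exact Or.inl ⟨hinv i g x h1, fun h => h2 ((satu_inv g).1 h)⟩
    · exact Or.inr ((satu_inv g).2 h)
  · rw [Set.eq_univ_iff_forall]
    intro x
    by_cases hx : x ∈ satu G A
    · obtain ⟨g, hg⟩ := hx
      obtain ⟨y, hy⟩ := hWe (hAW hg)
      obtain ⟨i, hi⟩ := Set.mem_iUnion.1 (hTB (show y ∈ e ⁻¹' A by
        rw [Set.mem_preimage, hy]; exact hg))
      exact Set.mem_iUnion.2 ⟨i, Or.inr ⟨g, y, hi, hy⟩⟩
    · have : x ∈ ⋃ i, U i := by rw [hcov]; trivial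
      obtain ⟨i, hi⟩ := Set.mem_iUnion.1 this
      exact Set.mem_iUnion.2 ⟨i, Or.inl ⟨hi, hx⟩⟩
  · rintro i x (⟨h1, h2⟩ | ⟨g, hg⟩)
    · exact h1
    · have := hinv i g⁻¹ _ (hVW i hg).1
      rwa [inv_smul_smul] at this
  · intro x hx S hS
    obtain ⟨y, rfl⟩ := hWe (hAW hx)
    refine hTord y S fun i hi => ?_
    rcases hS i hi with ⟨_, h2⟩ | ⟨g, hg⟩
    · exact absurd (sub_satu hx) h2
    · have := hWg g (e y) (hAW hx) (hVW i hg).2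
      subst this
      rw [one_smul] at hg
      obtain ⟨y', hy', hyy⟩ := hg
      rwa [← he.injective hyy]

theorem all_refine {J Λ : Type*} [Fintype Λ] (U : J → Set M) (hU : ∀ i, IsOpen (U i))
    (hinv : ∀ i (g : G) x, x ∈ U i → g • x ∈ U i) (hcov : ⋃ i, U i = Set.univ)
    (e : Λ → (κ → ℝ) → M) (he : ∀ l, Topology.IsOpenEmbedding (e l)) (W A : Λ → Set M)
    (hW : ∀ l, IsOpen (W l)) (hWe : ∀ l, W l ⊆ Set.range (e l))
    (hWg : ∀ l (g : G) x, x ∈ W l → g • x ∈ W l → g = 1)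
    (hA : ∀ l, IsClosed (A l)) (hAW : ∀ l, A l ⊆ W l) (hAcov : ⋃ l, A l = Set.univ) :
    ∃ U' : J → Set M, (∀ i, IsOpen (U' i)) ∧ (∀ i (g : G) x, x ∈ U' i → g • x ∈ U' i) ∧
      (⋃ i, U' i = Set.univ) ∧ (∀ i, U' i ⊆ U i) ∧
      ∀ x, OrdLE U' x (Fintype.card κ + 1) := by
  classical
  have key : ∀ S : Finset Λ, ∃ U' : J → Set M, (∀ i, IsOpen (U' i)) ∧
      (∀ i (g : G) x, x ∈ U' i → g • x ∈ U' i) ∧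
      (⋃ i, U' i = Set.univ) ∧ (∀ i, U' i ⊆ U i) ∧
      ∀ l ∈ S, ∀ x ∈ A l, OrdLE U' x (Fintype.card κ + 1) := by
    intro S
    induction S using Finset.induction_on with
    | empty => exact ⟨U, hU, hinv, hcov, fun _ => subset_rfl, by simp⟩
    | insert l S hl ih =>
      obtain ⟨U1, a1, a2, a3, a4, a5⟩ := ih
      obtain ⟨U2, b1, b2, b3, b4, b5⟩ := step_refine U1 a1 a2 a3 (e l) (he l) (W l) (A l) (hW l)
        (hWe l) (hWg l) (hA l) (hAW l)
      refine ⟨U2, b1, b2, b3, fun i => (b4 i).trans (a4 i), ?_⟩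
      intro l' hl' x hx
      rcases Finset.mem_insert.1 hl' with rfl | hl'
      · exact b5 x hx
      · exact fun T hT => a5 l' hl' x hx T fun i hi => b4 i (hT i hi)
  obtain ⟨U', a1, a2, a3, a4, a5⟩ := key Finset.univ
  refine ⟨U', a1, a2, a3, a4, fun x => ?_⟩
  have : x ∈ ⋃ l, A l := by rw [hAcov]; trivial
  obtain ⟨l, hl⟩ := Set.mem_iUnion.1 this
  exact a5 l (Finset.mem_univ _) x hl
end act

open Function
open scoped unitInterval

section upB

theorem glue_exists {M J : Type*} [TopologicalSpace M] (O : J → Set M) (hO : ∀ j, IsOpen (O j))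
    (hdis : ∀ i j x, x ∈ O i → x ∈ O j → i = j) (F : J → M → I → M)
    (hF : ∀ j, ContinuousOn (uncurry (F j)) (O j ×ˢ Set.univ)) :
    ∃ H : M → I → M, (∀ j, ∀ x ∈ O j, H x = F j x) ∧
      ContinuousOn (uncurry H) ((⋃ j, O j) ×ˢ Set.univ) := by
  classical
  let H : M → I → M := fun x => if h : ∃ j, x ∈ O j then F h.choose x else fun _ => x
  have hH : ∀ j, ∀ x ∈ O j, H x = F j x := by
    intro j x hx
    have h : ∃ j, x ∈ O j := ⟨j, hx⟩
    have e : h.choose = j := hdis _ _ x h.choose_spec hx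
    simp only [H, dif_pos h]
    rw [e]
  refine ⟨H, hH, ?_⟩
  rintro ⟨x, t⟩ ⟨hx, -⟩
  obtain ⟨j, hj⟩ := Set.mem_iUnion.1 hx
  have hop : IsOpen (O j ×ˢ (Set.univ : Set I)) := (hO j).prod isOpen_univ
  have hmem : (x, t) ∈ O j ×ˢ (Set.univ : Set I) := ⟨hj, trivial⟩
  have h1 : ContinuousAt (uncurry (F j)) (x, t) :=
    (hF j).continuousAt (hop.mem_nhds hmem)
  refine ContinuousAt.continuousWithinAt (h1.congr ?_)
  filter_upwards [hop.mem_nhds hmem] with y hy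
  exact (congrFun (hH j y.1 hy.1) y.2).symm

variable {M G κ : Type*} [TopologicalSpace M] [CompactSpace M] [T2Space M] [Group G] [Finite G]
  [MulAction G M] [ContinuousConstSMul G M] [Fintype κ]

/-- `O` deforms equivariantly in `M` into the orbit of `p`. -/
def Good (G : Type*) {M : Type*} [TopologicalSpace M] [Group G] [MulAction G M]
    (p : M) (O : Set M) : Prop :=
  ∃ H : M → I → M, ContinuousOn (uncurry H) (O ×ˢ Set.univ) ∧ (∀ x ∈ O, H x 1 = x) ∧
    (∀ x ∈ O, ∃ g : G, H x 0 = g • p) ∧ ∀ (g : G), ∀ x ∈ O, ∀ t, H (g • x) t = g • H x t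

theorem Good.mono {p : M} {O O' : Set M} (h : Good G p O) (hs : O' ⊆ O) : Good G p O' := by
  obtain ⟨H, h1, h2, h3, h4⟩ := h
  exact ⟨H, h1.mono (Set.prod_mono hs subset_rfl), fun x hx => h2 x (hs hx),
    fun x hx => h3 x (hs hx), fun g x hx => h4 g x (hs hx)⟩

theorem Good.union {J : Type*} {p : M} (O : J → Set M) (hO : ∀ j, IsOpen (O j))
    (hdis : ∀ i j x, x ∈ O i → x ∈ O j → i = j)
    (hinv : ∀ j (g : G) x, x ∈ O j → g • x ∈ O j) (h : ∀ j, Good G p (O j)) :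
    Good G p (⋃ j, O j) := by
  choose F h1 h2 h3 h4 using h
  obtain ⟨H, hH, hc⟩ := glue_exists O hO hdis F h1
  refine ⟨H, hc, ?_, ?_, ?_⟩
  · intro x hx
    obtain ⟨j, hj⟩ := Set.mem_iUnion.1 hx
    rw [hH j x hj, h2 j x hj]
  · intro x hx
    obtain ⟨j, hj⟩ := Set.mem_iUnion.1 hx
    rw [hH j x hj]; exact h3 j x hj
  · intro g x hx t
    obtain ⟨j, hj⟩ := Set.mem_iUnion.1 hx
    rw [hH j x hj, hH j _ (hinv j g x hj)]; exact h4 j g x hj t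

theorem good_satu (e : (κ → ℝ) → M) (he : Topology.IsOpenEmbedding e) (W : Set M) (hW : IsOpen W)
    (hWe : W ⊆ Set.range e) (hWg : ∀ (g : G) x, x ∈ W → g • x ∈ W → g = 1)
    (p : M) (hp : p ∈ Set.range e) : Good G p (satu G W) := by
  classical
  let e' : M → (κ → ℝ) := invFun e
  have hee' : ∀ x ∈ Set.range e, e (e' x) = x := fun x hx => invFun_eq hx
  have he'e : ∀ y, e' (e y) = y := leftInverse_invFun he.injective
  have hce' : ContinuousOn e' (Set.range e) := by
    rintro _ ⟨y, rfl⟩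
    refine ContinuousAt.continuousWithinAt ?_
    rw [← he.continuousAt_iff]
    have : e' ∘ e = id := funext he'e
    rw [this]; exact continuousAt_id
  let O : G → Set M := fun g => {x | g • x ∈ W}
  let F : G → M → I → M := fun g x t =>
    g⁻¹ • e ((1 - (t : ℝ)) • e' p + (t : ℝ) • e' (g • x))
  have hdis : ∀ i j x, x ∈ O i → x ∈ O j → i = j := by
    intro i j x hi hj
    have : i * j⁻¹ = 1 := hWg (i * j⁻¹) (j • x) hj (by rw [mul_smul, inv_smul_smul]; exact hi)
    exact mul_inv_eq_one.1 this
  have hF : ∀ g, ContinuousOn (uncurry (F g)) (O g ×ˢ Set.univ) := by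
    intro g
    have h1 : ContinuousOn (fun q : M × I => e' (g • q.1)) (O g ×ˢ Set.univ) :=
      hce'.comp ((continuous_const_smul g).comp continuous_fst).continuousOn
        (fun q hq => hWe hq.1)
    have h2 : Continuous (fun q : M × I => (q.2 : ℝ)) := continuous_subtype_val.comp continuous_snd
    have h3 : ContinuousOn (fun q : M × I => (1 - (q.2 : ℝ)) • e' p + (q.2 : ℝ) • e' (g • q.1))
        (O g ×ˢ Set.univ) :=
      ((continuous_const.sub h2).smul continuous_const).continuousOn.add (h2.continuousOn.smul h1)
    exact (continuous_const_smul g⁻¹).comp_continuousOn (he.continuous.comp_continuousOn h3)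
  obtain ⟨H, hH, hc⟩ := glue_exists O (fun g => hW.preimage (continuous_const_smul g)) hdis F hF
  have hsat : satu G W = ⋃ g, O g := by
    ext x; simp only [Set.mem_iUnion]; exact Iff.rfl
  refine ⟨H, by rw [hsat]; exact hc, ?_, ?_, ?_⟩
  · rintro x ⟨g, hg⟩
    rw [hH g x hg]
    simp only [F, Set.Icc.coe_one, sub_self, zero_smul, one_smul, zero_add]
    rw [hee' _ (hWe hg), inv_smul_smul]
  · rintro x ⟨g, hg⟩
    refine ⟨g⁻¹, ?_⟩
    rw [hH g x hg]
    simp only [F, Set.Icc.coe_zero, sub_zero, zero_smul, one_smul, add_zero]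
    rw [hee' _ hp]
  · rintro k x ⟨g, hg⟩ t
    have h1 : k • x ∈ O (g * k⁻¹) := by
      show (g * k⁻¹) • k • x ∈ W
      rw [mul_smul, inv_smul_smul]; exact hg
    rw [hH g x hg, hH _ _ h1]
    simp only [F, mul_smul, inv_smul_smul, mul_inv_rev, inv_inv]

theorem good_color {Λ : Type*} [Fintype Λ] (m : ℕ) (p : M) (U : Λ → Set M)
    (hU : ∀ i, IsOpen (U i))
    (hinv : ∀ i (g : G) x, x ∈ U i → g • x ∈ U i) (hcov : ⋃ i, U i = Set.univ)
    (hord : ∀ x, OrdLE U x (m + 1)) (hgood : ∀ i, Good G p (U i)) :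
    ∃ V : Fin (m + 1) → Set M, (∀ i, IsOpen (V i)) ∧ (⋃ i, V i = Set.univ) ∧
      (∀ i (g : G) x, x ∈ V i → g • x ∈ V i) ∧ ∀ i, Good G p (V i) := by
  classical
  have := Fintype.ofFinite G
  obtain ⟨K, hKcov, hKcl, hKU⟩ := exists_iUnion_eq_closed_subset (u := U) hU
    (fun x => Set.toFinite _) hcov
  have hury : ∀ i, ∃ f : C(M, ℝ), Set.EqOn f 0 (U i)ᶜ ∧ Set.EqOn f 1 (K i) ∧
      ∀ x, f x ∈ Set.Icc (0 : ℝ) 1 := fun i =>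
    exists_continuous_zero_one_of_isClosed (hU i).isClosed_compl (hKcl i)
      (Set.disjoint_left.2 fun x hx hk => hx (hKU i hk))
  choose f hf0 hf1 hf2 using hury
  let φ : Λ → M → ℝ := fun i x => ∑ g : G, f i (g • x)
  have hφc : ∀ i, Continuous (φ i) := fun i =>
    continuous_finsetSum _ fun g _ => (f i).continuous.comp (continuous_const_smul g)
  have hφinv : ∀ i (g : G) x, φ i (g • x) = φ i x := by
    intro i g x
    simp only [φ, ← mul_smul]
    exact Fintype.sum_equiv (Equiv.mulRight g) _ _ fun h => rfl
  have hφpos : ∀ x, ∃ i, 0 < φ i x := by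
    intro x
    have : x ∈ ⋃ i, K i := by rw [hKcov]; trivial
    obtain ⟨i, hi⟩ := Set.mem_iUnion.1 this
    refine ⟨i, Finset.sum_pos' (fun g _ => (hf2 i _).1) ⟨1, Finset.mem_univ _, ?_⟩⟩
    rw [one_smul, hf1 i hi]; exact zero_lt_one
  have hφU : ∀ i x, 0 < φ i x → x ∈ U i := by
    intro i x h
    obtain ⟨g, -, hg⟩ := Finset.exists_ne_zero_of_sum_ne_zero h.ne'
    have : g • x ∈ U i := by
      by_contra hx; exact hg (hf0 i hx)
    have h2 := hinv i g⁻¹ _ this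
    rwa [inv_smul_smul] at h2
  let O : Finset Λ → Set M := fun S => {x | ∀ i ∈ S, 0 < φ i x ∧ ∀ j, j ∉ S → φ j x < φ i x}
  have hOo : ∀ S, IsOpen (O S) := by
    intro S
    have e : O S = ⋂ i ∈ S, ({x | 0 < φ i x} ∩ ⋂ j ∈ {j | j ∉ S}, {x | φ j x < φ i x}) := by
      ext x; simp [O]
    rw [e]
    refine isOpen_biInter_finset fun i _ => (isOpen_lt continuous_const (hφc i)).inter ?_
    exact (Set.toFinite _).isOpen_biInter fun j _ => isOpen_lt (hφc j) (hφc i)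
  have hOinv : ∀ S (g : G) x, x ∈ O S → g • x ∈ O S := by
    intro S g x hx i hi
    simp only [hφinv]
    exact hx i hi
  have hOdis : ∀ S T x, S.card = T.card → x ∈ O S → x ∈ O T → S = T := by
    intro S T x hc hS hT
    by_contra hne
    have h1 : ¬ S ⊆ T := fun h => hne (Finset.eq_of_subset_of_card_le h hc.ge)
    have h2 : ¬ T ⊆ S := fun h => hne (Finset.eq_of_subset_of_card_le h hc.le).symm
    obtain ⟨i, hi, hi'⟩ := Finset.not_subset.1 h1
    obtain ⟨j, hj, hj'⟩ := Finset.not_subset.1 h2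
    exact lt_asymm ((hS i hi).2 j hj') ((hT j hj).2 i hi')
  refine ⟨fun c => ⋃ S : {S : Finset Λ // S.card = c.1 + 1}, O S.1, ?_, ?_, ?_, ?_⟩
  · exact fun c => isOpen_iUnion fun S => hOo _
  · refine Set.eq_univ_of_forall fun x => ?_
    obtain ⟨i0, hi0⟩ := hφpos x
    obtain ⟨i1, -, hi1⟩ := Finset.exists_max_image Finset.univ (fun i => φ i x) ⟨i0, Finset.mem_univ _⟩
    let S : Finset Λ := Finset.univ.filter fun i => φ i x = φ i1 x
    have hmemS : ∀ i, i ∈ S ↔ φ i x = φ i1 x := fun i => by simp [S]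
    have hpos1 : 0 < φ i1 x := lt_of_lt_of_le hi0 (hi1 i0 (Finset.mem_univ _))
    have hxS : x ∈ O S := by
      intro i hi
      rw [(hmemS i).1 hi]
      refine ⟨hpos1, fun j hj => lt_of_le_of_ne (hi1 j (Finset.mem_univ _)) ?_⟩
      exact fun h => hj ((hmemS j).2 h)
    have hcard : S.card ≤ m + 1 := hord x S fun i hi => hφU i x (hxS i hi).1
    have hcpos : 0 < S.card := Finset.card_pos.2 ⟨i1, (hmemS i1).2 rfl⟩
    exact Set.mem_iUnion.2 ⟨⟨S.card - 1, by omega⟩,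
      Set.mem_iUnion.2 ⟨⟨S, by show S.card = S.card - 1 + 1; omega⟩, hxS⟩⟩
  · intro c g x hx
    obtain ⟨S, hS⟩ := Set.mem_iUnion.1 hx
    exact Set.mem_iUnion.2 ⟨S, hOinv _ g x hS⟩
  · intro c
    refine Good.union _ (fun S => hOo _) ?_ (fun S g x => hOinv _ g x) ?_
    · intro S T x hS hT
      exact Subtype.ext (hOdis _ _ x (S.2.trans T.2.symm) hS hT)
    · intro S
      obtain ⟨i, hi⟩ : S.1.Nonempty := Finset.card_pos.1 (by rw [S.2]; omega)
      exact (hgood i).mono fun x hx => hφU i x (hx i hi).1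

theorem upper_general (p : M)
    (hch : ∀ w : M, ∃ e : (κ → ℝ) → M, Topology.IsOpenEmbedding e ∧ w ∈ Set.range e ∧
      p ∈ Set.range e)
    (hfree : ∀ (g : G) (x : M), g • x = x → g = 1) :
    ∃ V : Fin (Fintype.card κ + 1) → Set M, (∀ i, IsOpen (V i)) ∧ (⋃ i, V i = Set.univ) ∧
      (∀ i (g : G) x, x ∈ V i → g • x ∈ V i) ∧ ∀ i, Good G p (V i) := by
  classical
  have hloc : ∀ w : M, ∃ e : (κ → ℝ) → M, ∃ W : Set M, Topology.IsOpenEmbedding e ∧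
      p ∈ Set.range e ∧ IsOpen W ∧ w ∈ W ∧ W ⊆ Set.range e ∧
      ∀ (g : G) x, x ∈ W → g • x ∈ W → g = 1 := by
    intro w
    obtain ⟨e, he, hw, hp⟩ := hch w
    have hsep : ∀ g : G, ∃ N : Set M, IsOpen N ∧ w ∈ N ∧
        ∀ x, x ∈ N → g • x ∈ N → g = 1 := by
      intro g
      by_cases hg : g = 1
      · exact ⟨Set.univ, isOpen_univ, trivial, fun _ _ _ => hg⟩
      · have hne : g • w ≠ w := fun h => hg (hfree g w h)
        obtain ⟨A, B, hA, hB, hwA, hwB, hAB⟩ := t2_separation hne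
        refine ⟨B ∩ (fun x => g • x) ⁻¹' A, hB.inter (hA.preimage (continuous_const_smul g)),
          ⟨hwB, hwA⟩, fun x hx hgx => ?_⟩
        exact absurd hgx.1 (Set.disjoint_left.1 hAB hx.2)
    choose N hN1 hN2 hN3 using hsep
    refine ⟨e, Set.range e ∩ ⋂ g, N g, he, hp, he.isOpen_range.inter (isOpen_iInter_of_finite hN1),
      ⟨hw, Set.mem_iInter.2 hN2⟩, Set.inter_subset_left, fun g x hx hgx => ?_⟩
    exact hN3 g x (Set.mem_iInter.1 hx.2 g) (Set.mem_iInter.1 hgx.2 g)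
  choose e W he hp hWo hwW hWe hWg using hloc
  obtain ⟨T, hT⟩ := isCompact_univ.elim_finite_subcover W hWo
    (fun x _ => Set.mem_iUnion.2 ⟨x, hwW x⟩)
  have hcov : ⋃ l : T, W l.1 = Set.univ := by
    refine Set.eq_univ_of_forall fun x => ?_
    obtain ⟨l, hl, hx⟩ := Set.mem_iUnion₂.1 (hT (Set.mem_univ x))
    exact Set.mem_iUnion.2 ⟨⟨l, hl⟩, hx⟩
  obtain ⟨A, hAcov, hAcl, hAW⟩ := exists_iUnion_eq_closed_subset (u := fun l : T => W l.1)
    (fun l => hWo _) (fun x => Set.toFinite _) hcov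
  obtain ⟨U', h1, h2, h3, h4, h5⟩ := all_refine (G := G) (fun l : T => satu G (W l.1))
    (fun l => satu_open (hWo _)) (fun l g x hx => (satu_inv g).2 hx)
    (Set.eq_univ_of_forall fun x => by
      have : x ∈ ⋃ l : T, W l.1 := by rw [hcov]; trivial
      obtain ⟨l, hl⟩ := Set.mem_iUnion.1 this
      exact Set.mem_iUnion.2 ⟨l, sub_satu hl⟩)
    (fun l : T => e l.1) (fun l => he _) (fun l => W l.1) A (fun l => hWo _) (fun l => hWe _)
    (fun l => hWg _) hAcl hAW hAcov
  exact good_color _ p U' h1 h2 h3 h5 fun l =>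
    (good_satu (e l.1) (he _) (W l.1) (hWo _) (hWe _) (hWg _) p (hp _)).mono (h4 l)

end upB

open Function
open scoped unitInterval

section charts

/-- `S` is an open set of `X` homeomorphic with a cell -/
def IsCell (κ : Type*) {X : Type*} [TopologicalSpace X] (S : Set X) : Prop :=
  ∃ (e : (κ → ℝ) → X) (J : X → (κ → ℝ)), Continuous e ∧ (∀ u, e u ∈ S) ∧ (∀ u, J (e u) = u) ∧
    (∀ q ∈ S, e (J q) = q) ∧ ContinuousOn J S ∧ IsOpen S

theorem IsCell.emb {κ X : Type*} [TopologicalSpace X] {S : Set X} (h : IsCell κ S) :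
    ∃ e : (κ → ℝ) → X, Topology.IsOpenEmbedding e ∧ Set.range e = S := by
  obtain ⟨e, J, he, heS, hJe, heJ, hJ, hS⟩ := h
  let E : OpenPartialHomeomorph (κ → ℝ) X :=
    { toFun := e
      invFun := J
      source := Set.univ
      target := S
      map_source' := fun u _ => heS u
      map_target' := fun _ _ => trivial
      left_inv' := fun u _ => hJe u
      right_inv' := fun q hq => heJ q hq
      open_source := isOpen_univ
      open_target := hS
      continuousOn_toFun := he.continuousOn
      continuousOn_invFun := hJ }
  refine ⟨e, E.isOpenEmbedding rfl, ?_⟩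
  ext q
  exact ⟨fun ⟨u, hu⟩ => hu ▸ heS u, fun hq => ⟨J q, heJ q hq⟩⟩

theorem IsCell.reindex {κ κ' X : Type*} [TopologicalSpace X] {S : Set X} (h : IsCell κ S)
    (f : κ ≃ κ') : IsCell κ' S := by
  obtain ⟨e, J, he, heS, hJe, heJ, hJ, hS⟩ := h
  refine ⟨fun u => e (fun i => u (f i)), fun q i => J q (f.symm i), ?_, fun u => heS _, ?_, ?_, ?_,
    hS⟩
  · exact he.comp (continuous_pi fun i => continuous_apply _)
  · intro u; funext i; simp only [hJe, Equiv.apply_symm_apply]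
  · intro q hq; simp only [Equiv.symm_apply_apply]; exact heJ q hq
  · exact continuousOn_pi.2 fun i => (continuousOn_pi.1 hJ) _

theorem IsCell.pi {κ X ι : Type*} [Finite ι] [TopologicalSpace X] {S : ι → Set X}
    (h : ∀ i, IsCell κ (S i)) : IsCell (ι × κ) {w : ι → X | ∀ i, w i ∈ S i} := by
  choose e J he heS hJe heJ hJ hS using h
  refine ⟨fun u i => e i (fun k => u (i, k)), fun w ik => J ik.1 (w ik.1) ik.2, ?_,
    fun u i => heS _ _, ?_, ?_, ?_, ?_⟩
  · exact continuous_pi fun i => (he i).comp (continuous_pi fun k => continuous_apply _)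
  · intro u; funext ik; simp only [hJe]
  · intro w hw; funext i; exact heJ i _ (hw i)
  · refine continuousOn_pi.2 fun ik => ?_
    exact (continuousOn_pi.1 (hJ ik.1) ik.2).comp (continuous_apply ik.1).continuousOn
      fun w hw => hw ik.1
  · have : {w : ι → X | ∀ i, w i ∈ S i} = ⋂ i, (fun w : ι → X => w i) ⁻¹' S i := by
      ext w; simp
    rw [this]
    exact isOpen_iInter_of_finite fun i => (hS i).preimage (continuous_apply i)

theorem mdot_eq {r s : ℕ} (h : s ≤ r) (x : Fin (r + 1) → ℝ) (y : Fin (s + 1) → ℝ) :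
    mdot r s x y = ∑ j : Fin (s + 1), x (Fin.castLE (by omega) j) * y j := by
  unfold mdot
  exact Fintype.sum_equiv (finCongr (by omega)) _ _ fun j => rfl

variable {r s : ℕ}

/-- the free x-coordinates, with `x_a = 1` and `x_B = 0` -/
noncomputable def chX (a B : Fin (r + 1)) (u : {i : Fin (r + 1) // i ≠ a ∧ i ≠ B} → ℝ) : Fin (r + 1) → ℝ :=
  fun i => if h : i ≠ a ∧ i ≠ B then u ⟨i, h⟩ else if i = a then 1 else 0

noncomputable def chY (b : Fin (s + 1)) (v : {j : Fin (s + 1) // j ≠ b} → ℝ) : Fin (s + 1) → ℝ :=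
  fun j => if h : j ≠ b then v ⟨j, h⟩ else 1

noncomputable def chC (h : s ≤ r) (x : Fin (r + 1) → ℝ) (y : Fin (s + 1) → ℝ) : ℝ :=
  - ∑ j : Fin (s + 1), x (Fin.castLE (by omega) j) * y j

theorem mdot_update (h : s ≤ r) (b : Fin (s + 1)) (x : Fin (r + 1) → ℝ) (y : Fin (s + 1) → ℝ)
    (hx : x (Fin.castLE (by omega) b) = 0) (hy : y b = 1) (c : ℝ) :
    mdot r s (update x (Fin.castLE (by omega) b) c) y = c - chC h x y := by
  rw [mdot_eq h, chC, sub_neg_eq_add, ← Finset.add_sum_erase _ _ (Finset.mem_univ b),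
    ← Finset.add_sum_erase (a := b) (s := Finset.univ)
      (fun j => x (Fin.castLE (by omega) j) * y j) (Finset.mem_univ b)]
  rw [update_self, hx, hy, mul_one, zero_mul, zero_add]
  congr 1
  refine Finset.sum_congr rfl fun j hj => ?_
  rw [update_of_ne]
  intro he
  exact (Finset.mem_erase.1 hj).1 (Fin.castLE_injective _ he)

theorem chX_cont (a B : Fin (r + 1)) : Continuous (chX a B) := by
  refine continuous_pi fun i => ?_
  by_cases h : i ≠ a ∧ i ≠ B
  · simp only [chX, dif_pos h]; exact continuous_apply _
  · simp only [chX, dif_neg h]; exact continuous_const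

theorem chY_cont (b : Fin (s + 1)) : Continuous (chY b) := by
  refine continuous_pi fun i => ?_
  by_cases h : i ≠ b
  · simp only [chY, dif_pos h]; exact continuous_apply _
  · simp only [chY, dif_neg h]; exact continuous_const

theorem milnor_cell (h : s ≤ r) (a : Fin (r + 1)) (b : Fin (s + 1)) (hab : a.1 ≠ b.1) :
    IsCell ({i : Fin (r + 1) // i ≠ a ∧ i ≠ Fin.castLE (by omega) b} ⊕ {j : Fin (s + 1) // j ≠ b})
      {q : RealMilnor r s | pm q.1.1 a a ≠ 0 ∧ pm q.1.2 b b ≠ 0} := by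
  obtain ⟨B, hB⟩ : ∃ B : Fin (r + 1), B = Fin.castLE (by omega) b := ⟨_, rfl⟩
  rw [← hB]
  have haB : a ≠ B := by
    intro hh; apply hab; rw [hh, hB]; rfl
  let κ := {i : Fin (r + 1) // i ≠ a ∧ i ≠ B} ⊕ {j : Fin (s + 1) // j ≠ b}
  let x0 : (κ → ℝ) → Fin (r + 1) → ℝ := fun u => chX a B (fun i => u (Sum.inl i))
  let y : (κ → ℝ) → Fin (s + 1) → ℝ := fun u => chY b (fun i => u (Sum.inr i))
  let x : (κ → ℝ) → Fin (r + 1) → ℝ := fun u => update (x0 u) B (chC h (x0 u) (y u))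
  have hx0c : Continuous x0 := (chX_cont a B).comp (continuous_pi fun i => continuous_apply _)
  have hyc : Continuous y := (chY_cont b).comp (continuous_pi fun i => continuous_apply _)
  have hCc : Continuous fun u => chC h (x0 u) (y u) := by
    unfold chC
    exact (continuous_finsetSum _ fun j _ => ((continuous_apply _).comp hx0c).mul
      ((continuous_apply _).comp hyc)).neg
  have hxc : Continuous x := hx0c.update B hCc
  have hx0B : ∀ u, chX a B u B = 0 := by
    intro u; simp [chX, haB.symm]
  have hx0a : ∀ u, chX a B u a = 1 := by
    intro u; simp [chX]
  have hyb : ∀ v, chY b v b = 1 := by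
    intro u; simp [chY]
  have hxa : ∀ u, x u a = 1 := by
    intro u; show update (x0 u) B _ a = 1
    rw [update_of_ne haB]; exact hx0a _
  have hxne : ∀ u, x u ≠ 0 := fun u hh => by
    have := hxa u; rw [hh] at this; exact zero_ne_one this
  have hyne : ∀ u, y u ≠ 0 := fun u hh => by
    have : y u b = 1 := hyb _
    rw [hh] at this; exact zero_ne_one this
  have hmem : ∀ u, (pmk ⟨x u, hxne u⟩, pmk ⟨y u, hyne u⟩) ∈ RealMilnor r s := by
    intro u
    rw [mem_milnor_iff]
    show mdot r s (update (x0 u) B (chC h (x0 u) (y u))) (y u) = 0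
    have := mdot_update h b (x0 u) (y u) (by rw [← hB]; exact hx0B _) (hyb _) (chC h (x0 u) (y u))
    rw [← hB] at this
    rw [this, sub_self]
  let e : (κ → ℝ) → RealMilnor r s := fun u => ⟨(pmk ⟨x u, hxne u⟩, pmk ⟨y u, hyne u⟩), hmem u⟩
  let J : RealMilnor r s → κ → ℝ := fun q => Sum.elim (fun i => pm q.1.1 i.1 a / pm q.1.1 a a)
    (fun j => pm q.1.2 j.1 b / pm q.1.2 b b)
  have c1 : ∀ i j, Continuous fun q : RealMilnor r s => pm q.1.1 i j := fun i j =>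
    (pm_cont_apply i j).comp (continuous_fst.comp continuous_subtype_val)
  have c2 : ∀ i j, Continuous fun q : RealMilnor r s => pm q.1.2 i j := fun i j =>
    (pm_cont_apply i j).comp (continuous_snd.comp continuous_subtype_val)
  refine ⟨e, J, ?_, ?_, ?_, ?_, ?_, ?_⟩
  · refine Continuous.subtype_mk (Continuous.prodMk ?_ ?_) _
    · exact Continuous.comp (g := pmk) (f := fun u => ⟨x u, hxne u⟩) pmk_continuous (hxc.subtype_mk _)
    · exact Continuous.comp (g := pmk) (f := fun u => ⟨y u, hyne u⟩) pmk_continuous (hyc.subtype_mk _)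
  · intro u
    have d1 := dot_self_ne ⟨x u, hxne u⟩
    have d2 := dot_self_ne ⟨y u, hyne u⟩
    constructor
    · show pm (pmk ⟨x u, hxne u⟩) a a ≠ 0
      rw [pm_pmk]
      refine div_ne_zero ?_ d1
      show x u a * x u a ≠ 0
      rw [hxa]; norm_num
    · show pm (pmk ⟨y u, hyne u⟩) b b ≠ 0
      rw [pm_pmk]
      refine div_ne_zero ?_ d2
      have hyu : y u b = 1 := hyb _
      show y u b * y u b ≠ 0
      rw [hyu]; norm_num
  · intro u
    have d1 := dot_self_ne ⟨x u, hxne u⟩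
    have d2 := dot_self_ne ⟨y u, hyne u⟩
    funext k
    rcases k with i | j
    · show pm (pmk ⟨x u, hxne u⟩) i.1 a / pm (pmk ⟨x u, hxne u⟩) a a = u (Sum.inl i)
      rw [pm_pmk, pm_pmk, div_div_div_cancel_right₀ d1]
      show x u i.1 * x u a / (x u a * x u a) = _
      rw [hxa]
      have : x u i.1 = u (Sum.inl i) := by
        show update (x0 u) B _ i.1 = _
        rw [update_of_ne i.2.2]
        show chX a B _ i.1 = _
        simp only [chX, dif_pos i.2]
      rw [this]; norm_num
    · show pm (pmk ⟨y u, hyne u⟩) j.1 b / pm (pmk ⟨y u, hyne u⟩) b b = u (Sum.inr j)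
      rw [pm_pmk, pm_pmk, div_div_div_cancel_right₀ d2]
      have hyu : y u b = 1 := hyb _
      have hyj : y u j.1 = u (Sum.inr j) := by
        show chY b (fun i => u (Sum.inr i)) j.1 = _
        simp only [chY, dif_pos j.2]
      show y u j.1 * y u b / (y u b * y u b) = _
      rw [hyu, hyj]; norm_num
  · rintro ⟨⟨qx, qy⟩, hq⟩ ⟨ha, hb⟩
    obtain ⟨X, rfl⟩ := pmk_surj qx
    obtain ⟨Y, rfl⟩ := pmk_surj qy
    have d1 := dot_self_ne X
    have d2 := dot_self_ne Y
    have ha : pm (pmk X) a a ≠ 0 := ha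
    have hb : pm (pmk Y) b b ≠ 0 := hb
    rw [pm_pmk] at ha hb
    have hXa : X.1 a ≠ 0 := fun h0 => ha (by rw [h0]; simp)
    have hYb : Y.1 b ≠ 0 := fun h0 => hb (by rw [h0]; simp)
    rw [mem_milnor_iff] at hq
    set q : RealMilnor r s := ⟨(pmk X, pmk Y), (mem_milnor_iff X Y).2 hq⟩ with hqdef
    have hJl : ∀ i, J q (Sum.inl i) = (X.1 a)⁻¹ * X.1 i.1 := by
      intro i
      show pm (pmk X) i.1 a / pm (pmk X) a a = _
      rw [pm_pmk, pm_pmk, div_div_div_cancel_right₀ d1]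
      field_simp
    have hJr : ∀ i, J q (Sum.inr i) = (Y.1 b)⁻¹ * Y.1 i.1 := by
      intro i
      show pm (pmk Y) i.1 b / pm (pmk Y) b b = _
      rw [pm_pmk, pm_pmk, div_div_div_cancel_right₀ d2]
      field_simp
    have hy : y (J q) = (Y.1 b)⁻¹ • Y.1 := by
      funext j
      show chY b (fun i => J q (Sum.inr i)) j = (Y.1 b)⁻¹ * Y.1 j
      by_cases hj : j = b
      · subst hj; rw [hyb, inv_mul_cancel₀ hYb]
      · simp only [chY, dif_pos (show j ≠ b from hj), hJr]
    have hX : (X.1 a)⁻¹ • X.1 = update (x0 (J q)) B ((X.1 a)⁻¹ * X.1 B) := by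
      funext i
      by_cases hi : i = B
      · subst hi; rw [update_self]; rfl
      · rw [update_of_ne hi]
        show (X.1 a)⁻¹ * X.1 i = chX a B (fun i => J q (Sum.inl i)) i
        by_cases hia : i = a
        · subst hia; rw [hx0a, inv_mul_cancel₀ hXa]
        · simp only [chX, dif_pos (show i ≠ a ∧ i ≠ B from ⟨hia, hi⟩), hJl]
    have hz : mdot r s ((X.1 a)⁻¹ • X.1) ((Y.1 b)⁻¹ • Y.1) = 0 := by
      have : mdot r s ((X.1 a)⁻¹ • X.1) ((Y.1 b)⁻¹ • Y.1) = (X.1 a)⁻¹ * (Y.1 b)⁻¹ * mdot r s X.1 Y.1 := by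
        unfold mdot
        rw [Finset.mul_sum]
        refine Finset.sum_congr rfl fun j _ => ?_
        simp only [Pi.smul_apply, smul_eq_mul]; ring
      rw [this, hq, mul_zero]
    have hx : x (J q) = (X.1 a)⁻¹ • X.1 := by
      rw [hX, ← hy] at hz
      have h3 := mdot_update h b (x0 (J q)) (y (J q)) (by rw [← hB]; exact hx0B _) (hyb _)
        ((X.1 a)⁻¹ * X.1 B)
      rw [← hB, hz] at h3
      rw [hX]
      show update (x0 (J q)) B (chC h (x0 (J q)) (y (J q))) = _
      rw [sub_eq_zero.1 h3.symm]
    apply Subtype.ext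
    show (pmk ⟨x (J q), hxne _⟩, pmk ⟨y (J q), hyne _⟩) = (pmk X, pmk Y)
    rw [Prod.mk.injEq]
    exact ⟨(pmk_eq_iff _ _).2 ⟨_, inv_ne_zero hXa, hx⟩, (pmk_eq_iff _ _).2 ⟨_, inv_ne_zero hYb, hy⟩⟩
  · refine continuousOn_pi.2 fun k => ?_
    rcases k with i | j
    · exact ((c1 i.1 a).continuousOn).div (c1 a a).continuousOn fun q hq => hq.1
    · exact ((c2 j.1 b).continuousOn).div (c2 b b).continuousOn fun q hq => hq.2
  · exact (isOpen_ne_fun (c1 a a) continuous_const).inter (isOpen_ne_fun (c2 b b) continuous_const)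

theorem milnor_charts (h : s < r) (hs : Odd s) :
    ∃ p : RealMilnor r s, ∀ w : RealMilnor r s, ∃ S : Set (RealMilnor r s),
      IsCell (Fin (s + r - 1)) S ∧ w ∈ S ∧ p ∈ S := by
  have hp1 : (fun _ => 1 : Fin (r + 1) → ℝ) ≠ 0 := fun h0 => one_ne_zero (congrFun h0 0)
  have hp2 : (fun j => (-1) ^ j.1 : Fin (s + 1) → ℝ) ≠ 0 := fun h0 => by
    have := congrFun h0 0
    simp at this
  have hp : (pmk ⟨_, hp1⟩, pmk ⟨_, hp2⟩) ∈ RealMilnor r s := by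
    rw [mem_milnor_iff, mdot_eq h.le]
    simp only [one_mul]
    rw [Fin.sum_univ_eq_sum_range (fun j => (-1 : ℝ) ^ j), neg_one_geom_sum, if_pos]
    exact hs.add_one
  refine ⟨⟨_, hp⟩, ?_⟩
  rintro ⟨⟨qx, qy⟩, hq⟩
  obtain ⟨X, rfl⟩ := pmk_surj qx
  obtain ⟨Y, rfl⟩ := pmk_surj qy
  have hq' := hq
  rw [mem_milnor_iff, mdot_eq h.le] at hq'
  have hne : ∃ (a : Fin (r + 1)) (b : Fin (s + 1)), a.1 ≠ b.1 ∧ X.1 a ≠ 0 ∧ Y.1 b ≠ 0 := by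
    by_contra hcon
    push Not at hcon
    obtain ⟨a, ha⟩ := Function.ne_iff.1 X.2
    obtain ⟨b, hb⟩ := Function.ne_iff.1 Y.2
    have hab : a.1 = b.1 := by
      by_contra hh; exact hb (hcon a b hh ha)
    rw [Finset.sum_eq_single b] at hq'
    · have : Fin.castLE (by omega) b = a := Fin.ext hab.symm
      rw [this] at hq'
      exact mul_ne_zero ha hb hq'
    · intro j _ hj
      rw [hcon a j (by rw [hab]; exact fun h0 => hj (Fin.ext h0.symm)) ha, mul_zero]
    · exact fun h0 => absurd (Finset.mem_univ _) h0
  obtain ⟨a, b, hab, ha, hb⟩ := hne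
  have hcell := milnor_cell h.le a b hab
  have hcard : Fintype.card ({i : Fin (r + 1) // i ≠ a ∧ i ≠ Fin.castLE (by omega) b} ⊕
      {j : Fin (s + 1) // j ≠ b}) = Fintype.card (Fin (s + r - 1)) := by
    have hne : a ≠ Fin.castLE (by omega) b := fun h0 => hab (by rw [h0]; rfl)
    rw [Fintype.card_sum, Fintype.card_fin]
    have e1 : Fintype.card {j : Fin (s + 1) // j ≠ b} = s := by
      rw [Fintype.card_subtype_compl]; simp
    have e2 : Fintype.card {i : Fin (r + 1) // i ≠ a ∧ i ≠ Fin.castLE (by omega) b} = r - 1 := by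
      rw [Fintype.card_subtype]
      have : (Finset.univ.filter fun i : Fin (r + 1) => i ≠ a ∧ i ≠ Fin.castLE (by omega) b) =
          (Finset.univ.erase (Fin.castLE (by omega) b)).erase a := by
        ext i; simp
      rw [this, Finset.card_erase_of_mem, Finset.card_erase_of_mem] 
      · simp
      · simp
      · simp [hne]
    rw [e1, e2]; omega
  refine ⟨_, hcell.reindex (Fintype.equivOfCardEq hcard), ⟨?_, ?_⟩, ⟨?_, ?_⟩⟩
  · show pm (pmk X) a a ≠ 0
    rw [pm_pmk]; exact div_ne_zero (mul_ne_zero ha ha) (dot_self_ne X)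
  · show pm (pmk Y) b b ≠ 0
    rw [pm_pmk]; exact div_ne_zero (mul_ne_zero hb hb) (dot_self_ne Y)
  · show pm (pmk ⟨_, hp1⟩) a a ≠ 0
    rw [pm_pmk]; exact div_ne_zero (by norm_num) (dot_self_ne ⟨_, hp1⟩)
  · show pm (pmk ⟨_, hp2⟩) b b ≠ 0
    rw [pm_pmk]
    refine div_ne_zero ?_ (dot_self_ne ⟨_, hp2⟩)
    show (-1 : ℝ) ^ b.1 * (-1 : ℝ) ^ b.1 ≠ 0
    exact mul_ne_zero (pow_ne_zero _ (by norm_num)) (pow_ne_zero _ (by norm_num))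

theorem milnor_pow_charts (h : s < r) (hs : Odd s) (n : ℕ) :
    ∃ p : RealMilnor r s, ∀ w : Fin n → RealMilnor r s,
      ∃ e : (Fin n × Fin (s + r - 1) → ℝ) → (Fin n → RealMilnor r s),
      Topology.IsOpenEmbedding e ∧ w ∈ Set.range e ∧ (fun _ => p) ∈ Set.range e := by
  obtain ⟨p, hp⟩ := milnor_charts h hs
  refine ⟨p, fun w => ?_⟩
  choose S hS hw hpS using fun i => hp (w i)
  obtain ⟨e, he, hr⟩ := (IsCell.pi hS).emb
  exact ⟨e, he, by rw [hr]; exact hw, by rw [hr]; exact hpS⟩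

end charts

open Function
open scoped unitInterval

section final

theorem sec_of_good {G X : Type*} [Group G] [TopologicalSpace X] [MulAction G X] (n : ℕ)
    (hn : 0 < n) (p : X) (V : Set (Fin n → X)) (h : Good G (fun _ : Fin n => p) V) :
    ∃ sec : C(V, C(I, X)),
      (∀ (g : G) (v : V) (hgv : g • (v : Fin n → X) ∈ V) (t : I),
        (sec ⟨g • (v : Fin n → X), hgv⟩) t = g • (sec v) t) ∧
      ∃ H : C(V × I, Fin n → X),
        (∀ v : V, H (v, 0) = tcPi X n (sec v)) ∧
        (∀ v : V, H (v, 1) = (v : Fin n → X)) ∧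
        (∀ (g : G) (v : V) (hgv : g • (v : Fin n → X) ∈ V) (t : I),
          H (⟨g • (v : Fin n → X), hgv⟩, t) = g • H (v, t)) := by
  obtain ⟨H, hc, h1, h0, heq⟩ := h
  have hHc : Continuous fun q : V × I => H q.1.1 q.2 :=
    hc.comp_continuous (f := fun q : V × I => ((q.1 : Fin n → X), q.2))
      ((continuous_subtype_val.comp continuous_fst).prodMk continuous_snd)
      fun q => ⟨q.1.2, trivial⟩
  have h00 : Continuous fun v : V => H v.1 0 ⟨0, hn⟩ :=
    (continuous_apply _).comp (hHc.comp (continuous_id.prodMk continuous_const))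
  refine ⟨⟨fun v => ContinuousMap.const I (H v.1 0 ⟨0, hn⟩),
    ContinuousMap.continuous_of_continuous_uncurry _ (h00.comp continuous_fst)⟩, ?_,
    ⟨fun q => H q.1.1 q.2, hHc⟩, ?_, ?_, ?_⟩
  · intro g v hgv t
    show H (g • v.1) 0 _ = g • H v.1 0 _
    rw [heq g v.1 v.2]; rfl
  · intro v
    show H v.1 0 = fun _ => H v.1 0 ⟨0, hn⟩
    obtain ⟨g, hg⟩ := h0 v.1 v.2
    rw [hg]; rfl
  · intro v; exact h1 v.1 v.2
  · intro g v hgv t; exact heq g v.1 v.2 t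

theorem upper_set (r s n : ℕ) (hsr : s < r) (hsodd : Odd s) (hn : 2 ≤ n)
    [MulAction (Multiplicative (ZMod 2)) (↥(RealMilnor r s))]
    [ContinuousSMul (Multiplicative (ZMod 2)) (↥(RealMilnor r s))]
    (hfree : ∀ (g : Multiplicative (ZMod 2)) (x : ↥(RealMilnor r s)), g • x = x → g = 1) :
    ∃ U : Fin (n * (s + r - 1) + 1) → Set (Fin n → RealMilnor r s),
    (∀ i, IsOpen (U i)) ∧ (⋃ i, U i) = Set.univ ∧
    (∀ i (g : Multiplicative (ZMod 2)), ∀ v ∈ U i, g • v ∈ U i) ∧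
    ∀ i, Good (Multiplicative (ZMod 2)) (fun _ => (milnor_pow_charts hsr hsodd n).choose) (U i) := by
  have hF : Finite (Multiplicative (ZMod 2)) := inferInstanceAs (Finite (ZMod 2))
  have key := upper_general (G := Multiplicative (ZMod 2)) (κ := Fin n × Fin (s + r - 1))
    (fun _ : Fin n => (milnor_pow_charts hsr hsodd n).choose)
    (milnor_pow_charts hsr hsodd n).choose_spec
    (fun g x hx => hfree g (x ⟨0, by omega⟩) (congrFun hx ⟨0, by omega⟩))
  have hcard : Fintype.card (Fin n × Fin (s + r - 1)) = n * (s + r - 1) := by simp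
  rw [hcard] at key
  exact key

theorem main_bounds (r s n t : ℕ) (hsr : s < r)
    (hrodd : Odd r) (hsodd : Odd s) (ht : 0 < t) (hrt : 2 ^ t ≤ r)
    (hn : 2 ≤ n)
    [MulAction (Multiplicative (ZMod 2)) (↥(RealMilnor r s))]
    [ContinuousSMul (Multiplicative (ZMod 2)) (↥(RealMilnor r s))]
    (hfree : ∀ (g : Multiplicative (ZMod 2)) (x : ↥(RealMilnor r s)), g • x = x → g = 1) :
    n * (2 ^ t + s - 1) - s + 2 ≤
        eqHigherTC (Multiplicative (ZMod 2)) (↥(RealMilnor r s)) n ∧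
      eqHigherTC (Multiplicative (ZMod 2)) (↥(RealMilnor r s)) n ≤ n * (s + r - 1) + 1 := by
  have hmem : 0 < n * (s + r - 1) + 1 ∧ ∃ U : Fin (n * (s + r - 1) + 1) → Set (Fin n → RealMilnor r s),
    (∀ i, IsOpen (U i)) ∧ (⋃ i, U i) = Set.univ ∧
    (∀ i (g : Multiplicative (ZMod 2)), ∀ v ∈ U i, g • v ∈ U i) ∧
    ∀ i, ∃ sec : C(U i, C(I, RealMilnor r s)),
      (∀ (g : Multiplicative (ZMod 2)) (v : U i) (hgv : g • (v : Fin n → RealMilnor r s) ∈ U i)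
          (t : I), (sec ⟨g • (v : Fin n → RealMilnor r s), hgv⟩) t = g • (sec v) t) ∧
      ∃ H : C(U i × I, Fin n → RealMilnor r s),
        (∀ v : U i, H (v, 0) = tcPi (RealMilnor r s) n (sec v)) ∧
        (∀ v : U i, H (v, 1) = (v : Fin n → RealMilnor r s)) ∧
        (∀ (g : Multiplicative (ZMod 2)) (v : U i)
          (hgv : g • (v : Fin n → RealMilnor r s) ∈ U i) (t : I),
          H (⟨g • (v : Fin n → RealMilnor r s), hgv⟩, t) = g • H (v, t)) := by
    obtain ⟨U, h1, h2, h3, h4⟩ := upper_set r s n hsr hsodd hn hfree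
    exact ⟨Nat.succ_pos _, U, h1, h2, h3, fun i => sec_of_good n (by omega) _ _ (h4 i)⟩
  refine ⟨?_, Nat.sInf_le hmem⟩
  have hk := Nat.sInf_mem (s := {k | 0 < k ∧ ∃ U : Fin k → Set (Fin n → RealMilnor r s),
    (∀ i, IsOpen (U i)) ∧ (⋃ i, U i) = Set.univ ∧
    (∀ i (g : Multiplicative (ZMod 2)), ∀ v ∈ U i, g • v ∈ U i) ∧
    ∀ i, ∃ sec : C(U i, C(I, RealMilnor r s)),
      (∀ (g : Multiplicative (ZMod 2)) (v : U i) (hgv : g • (v : Fin n → RealMilnor r s) ∈ U i)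
          (t : I), (sec ⟨g • (v : Fin n → RealMilnor r s), hgv⟩) t = g • (sec v) t) ∧
      ∃ H : C(U i × I, Fin n → RealMilnor r s),
        (∀ v : U i, H (v, 0) = tcPi (RealMilnor r s) n (sec v)) ∧
        (∀ v : U i, H (v, 1) = (v : Fin n → RealMilnor r s)) ∧
        (∀ (g : Multiplicative (ZMod 2)) (v : U i)
          (hgv : g • (v : Fin n → RealMilnor r s) ∈ U i) (t : I),
          H (⟨g • (v : Fin n → RealMilnor r s), hgv⟩, t) = g • H (v, t))}) ⟨_, hmem⟩
  obtain ⟨k, hkd⟩ : ∃ k, k = eqHigherTC (Multiplicative (ZMod 2)) (↥(RealMilnor r s)) n := ⟨_, rfl⟩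
  rw [← hkd]
  change _ ∧ _ at hk
  unfold eqHigherTC at hkd
  rw [← hkd] at hk
  obtain ⟨-, U, hU, hcov, -, hsec⟩ := hk
  obtain ⟨n, rfl⟩ : ∃ m, n = m + 2 := ⟨n - 2, by omega⟩
  have hrt1 : 2 ^ t + 1 ≤ r := by
    rcases hrt.lt_or_eq with hlt | he
    · exact hlt
    · exfalso
      obtain ⟨t', rfl⟩ : ∃ m, t = m + 1 := ⟨t - 1, by omega⟩
      obtain ⟨m, hm⟩ := hrodd
      rw [pow_succ] at he
      omega
  have hlow := lower_bound r s n t hsr.le hrt1 k U hU hcov (fun i => by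
    obtain ⟨sec, -, H, a, b, -⟩ := hsec i
    exact ⟨sec, H, a, b⟩)
  rw [listT1_length, listT2_length] at hlow
  obtain ⟨q, hq⟩ : ∃ q, 2 ^ t = q + 1 := ⟨2 ^ t - 1, by have := Nat.one_le_two_pow (n := t); omega⟩
  rw [pow_succ, hq] at hlow
  rw [hq]
  have e1 : q + 1 + s - 1 = q + s := by omega
  have e2 : q + 1 - 1 = q := by omega
  rw [e1]
  rw [e2] at hlow
  have e3 : (n + 2) * (q + s) = n * q + 2 * q + (n + 1) * s + s := by ring
  rw [e3]
  omega

end final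

/-- For `1 < s < r` with `r ≢ 2 (mod 4)`, `r, s` odd and `r ≥ 2^t`,
any free (continuous) `ℤ/2`-action on `ℝH_{r,s}` satisfies, for `n ≥ 2`:
`n(2^t+s-1) - s + 2 ≤ TC_{ℤ/2,n}(ℝH_{r,s}) ≤ n(s+r-1) + 1`; in particular for `s = 3`,
`r = 2^t+1`: `n(2^t+2) - 1 ≤ TC_{ℤ/2,n}(ℝH_{r,3}) ≤ n(2^t+3) + 1`. -/
theorem eqHigherTC_Z2_milnor' (r s n t : ℕ) (h1s : 1 < s) (hsr : s < r)
    (hr4 : r % 4 ≠ 2) (hrodd : Odd r) (hsodd : Odd s) (ht : 0 < t) (hrt : 2 ^ t ≤ r)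
    (hn : 2 ≤ n)
    [MulAction (Multiplicative (ZMod 2)) (↥(RealMilnor r s))]
    [ContinuousSMul (Multiplicative (ZMod 2)) (↥(RealMilnor r s))]
    (hfree : ∀ (g : Multiplicative (ZMod 2)) (x : ↥(RealMilnor r s)), g • x = x → g = 1) :
    (n * (2 ^ t + s - 1) - s + 2 ≤
        eqHigherTC (Multiplicative (ZMod 2)) (↥(RealMilnor r s)) n ∧
      eqHigherTC (Multiplicative (ZMod 2)) (↥(RealMilnor r s)) n ≤ n * (s + r - 1) + 1) ∧
    (s = 3 → r = 2 ^ t + 1 →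
      n * (2 ^ t + 2) - 1 ≤ eqHigherTC (Multiplicative (ZMod 2)) (↥(RealMilnor r s)) n ∧
      eqHigherTC (Multiplicative (ZMod 2)) (↥(RealMilnor r s)) n ≤ n * (2 ^ t + 3) + 1) := by
  have hb := main_bounds r s n t hsr hrodd hsodd ht hrt hn hfree
  refine ⟨hb, fun h3 hr => ?_⟩
  have e1 : 2 ^ t + s - 1 = 2 ^ t + 2 := by omega
  have e2 : s + r - 1 = 2 ^ t + 3 := by omega
  rw [e1, e2] at hb
  refine ⟨le_trans ?_ hb.1, hb.2⟩
  have : 2 * 3 ≤ n * (2 ^ t + 2) := Nat.mul_le_mul hn (by have := Nat.one_le_two_pow (n := t); omega)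
  omega
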